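/- arXiv:1608.03482 — 4 statements merged into one kernel-verified Lean document; each statement's English description precedes it below -/
import Mathlib

section
/- Let p be a prime, let F₁ and F₂ be non-abelian free groups, let G ≤ F₁ × F₂ be a full subdirect product, and set N₁ := G ∩ F₁. Then the following are equivalent: (1) G is p-conjugacy separable; (2) F₁/N₁ is a periodic residually-𝒞ₚ group, where 𝒞ₚ is the class of finite p-groups; (3) F₁/N₁ is a residually finite p-group (i.e., a periodic group in which every element has p-power order and which is residually finite). -/
/-- A bundled group (in universe 0). -/
structure GrpB where
  carrier : Type
  str : Group carrier

attribute [instance] GrpB.str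

/-- Bundle a group type. -/
def GrpB.of (G : Type) [h : Group G] : GrpB := ⟨G, h⟩

/-- `C` is a pseudovariety of groups: closed under isomorphism, subgroups,
binary direct products and quotients. -/
def IsPseudovariety (C : GrpB → Prop) : Prop :=
  (∀ A B : GrpB, C A → Nonempty (B.carrier ≃* A.carrier) → C B) ∧
  (∀ (A : GrpB) (H : Subgroup A.carrier), C A → C (GrpB.of H)) ∧
  (∀ A B : GrpB, C A → C B → C (GrpB.of (A.carrier × B.carrier))) ∧
  (∀ (A : GrpB) (N : Subgroup A.carrier) [N.Normal], C A → C (GrpB.of (A.carrier ⧸ N)))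

/-- `C` is extension-closed. -/
def IsExtensionClosed (C : GrpB → Prop) : Prop :=
  ∀ (A : GrpB) (N : Subgroup A.carrier) [N.Normal],
    C (GrpB.of N) → C (GrpB.of (A.carrier ⧸ N)) → C A

/-- Every member of `C` is a finite group. -/
def ClassOfFiniteGroups (C : GrpB → Prop) : Prop := ∀ A : GrpB, C A → Finite A.carrier

/-- `C` contains at least one non-trivial group. -/
def ClassNontrivial (C : GrpB → Prop) : Prop := ∃ A : GrpB, C A ∧ ∃ a : A.carrier, a ≠ 1

/-- `P` is residually-`C`. -/
def ResiduallyC (C : GrpB → Prop) (P : Type) [Group P] : Prop :=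
  ∀ p : P, p ≠ 1 → ∃ M : GrpB, C M ∧ ∃ φ : P →* M.carrier, φ p ≠ 1

/-- `G` is `C`-conjugacy separable. -/
def ConjSepC (C : GrpB → Prop) (G : Type) [Group G] : Prop :=
  ∀ x y : G, ¬ IsConj x y → ∃ M : GrpB, C M ∧ ∃ φ : G →* M.carrier, ¬ IsConj (φ x) (φ y)

/-- `N` is a co-`C` (normal) subgroup of `F`. -/
def IsCoC (C : GrpB → Prop) {F : Type} [Group F] (N : Subgroup F) : Prop :=
  ∃ hn : N.Normal, letI := hn; C (GrpB.of (F ⧸ N))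

/-- The pro-`C` topology on `F`: generated by the cosets of co-`C` subgroups. -/
def ProCTop (C : GrpB → Prop) (F : Type) [Group F] : TopologicalSpace F :=
  TopologicalSpace.generateFrom
    {S : Set F | ∃ N : Subgroup F, IsCoC C N ∧ ∃ g : F, S = {x : F | g⁻¹ * x ∈ N}}

/-- `X` is closed in the pro-`C` topology on `F`. -/
def CClosed (C : GrpB → Prop) {F : Type} [Group F] (X : Set F) : Prop :=
  @IsClosed F (ProCTop C F) X

/-- `X` is open in the pro-`C` topology on `F`. -/
def COpen (C : GrpB → Prop) {F : Type} [Group F] (X : Set F) : Prop :=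
  @IsOpen F (ProCTop C F) X

/-- Closure of `X` in the pro-`C` topology on `F`. -/
def CClosure (C : GrpB → Prop) {F : Type} [Group F] (X : Set F) : Set F :=
  @closure F (ProCTop C F) X

/-- `F` is `C`-hereditarily conjugacy separable: every `C`-open subgroup is
`C`-conjugacy separable. -/
def HerConjSepC (C : GrpB → Prop) (F : Type) [Group F] : Prop :=
  ∀ H : Subgroup F, COpen C (H : Set F) → ConjSepC C H

/-- `M` is cyclic subgroup `C`-separable: every cyclic subgroup is `C`-closed. -/
def CyclicSubgroupSepC (C : GrpB → Prop) (M : Type) [Group M] : Prop :=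
  ∀ m : M, CClosed C ((Subgroup.zpowers m : Subgroup M) : Set M)

/-- `M` is highly residually-`C`: every extension of a `C`-group by `M` is residually-`C`. -/
def HighlyResiduallyC (C : GrpB → Prop) (M : Type) [Group M] : Prop :=
  ∀ (L : Type) [Group L], ∀ (K : Subgroup L) [K.Normal],
    C (GrpB.of K) → Nonempty ((L ⧸ K) ≃* M) → ResiduallyC C L

/-- `F` has cyclic centralizers. -/
def HasCyclicCentralizers (F : Type) [Group F] : Prop :=
  ∀ f : F, f ≠ 1 → IsCyclic (Subgroup.centralizer ({f} : Set F))

/-- `G ≤ F₁ × F₂` is a subdirect product. -/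
def IsSubdirect {F₁ F₂ : Type} [Group F₁] [Group F₂] (G : Subgroup (F₁ × F₂)) : Prop :=
  Subgroup.map (MonoidHom.fst F₁ F₂) G = ⊤ ∧ Subgroup.map (MonoidHom.snd F₁ F₂) G = ⊤

/-- `G ≤ F₁ × F₂` is a full subdirect product. -/
def IsFullSubdirect {F₁ F₂ : Type} [Group F₁] [Group F₂] (G : Subgroup (F₁ × F₂)) : Prop :=
  IsSubdirect G ∧ Subgroup.comap (MonoidHom.inl F₁ F₂) G ≠ ⊥ ∧
    Subgroup.comap (MonoidHom.inr F₁ F₂) G ≠ ⊥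

/-- `F` is a free group (of arbitrary rank). -/
def IsFreeGroupType (F : Type) [Group F] : Prop := ∃ S : Type, Nonempty (F ≃* FreeGroup S)

/-- `F` is a non-abelian free group. -/
def IsNonAbelianFree (F : Type) [Group F] : Prop :=
  IsFreeGroupType F ∧ ∃ a b : F, a * b ≠ b * a

/-- The class of finite `p`-groups. -/
def CP (p : ℕ) : GrpB → Prop := fun A => Finite A.carrier ∧ IsPGroup p A.carrier

/-- The class of all finite groups. -/
def CFin : GrpB → Prop := fun A => Finite A.carrier

/-- A `Q'`-group: every element has finite order coprime to every `q ∈ Q`. -/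
def IsQPrimeGroup (Q : Set ℕ) (F : Type) [Group F] : Prop :=
  ∀ f : F, IsOfFinOrder f ∧ ∀ q ∈ Q, Nat.Coprime (orderOf f) q

/-- A normal subgroup whose quotient is a finite `p`-group. -/
structure Subgroup.IsCoP {F : Type*} [Group F] (p : ℕ) (L : Subgroup F) : Prop where
  normal : L.Normal
  finiteIndex : L.FiniteIndex
  pow_mem : ∀ g, ∃ k, g ^ p ^ k ∈ L

namespace Subgroup.IsCoP

variable {F E : Type*} [Group F] [Group E] {p : ℕ}

theorem top : (⊤ : Subgroup F).IsCoP p :=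
  ⟨inferInstance, inferInstance, fun _ => ⟨0, mem_top _⟩⟩

theorem inf {K L : Subgroup F} (hK : K.IsCoP p) (hL : L.IsCoP p) : (K ⊓ L).IsCoP p := by
  obtain ⟨_, _, hK⟩ := hK
  obtain ⟨_, _, hL⟩ := hL
  refine ⟨inferInstance, inferInstance, fun g => ?_⟩
  obtain ⟨k, hk⟩ := hK g
  obtain ⟨l, hl⟩ := hL g
  refine ⟨k + l, ?_, ?_⟩
  · rw [pow_add, pow_mul]; exact K.pow_mem hk _
  · rw [pow_add, mul_comm, pow_mul]; exact L.pow_mem hl _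

theorem mono {K L : Subgroup F} (hK : K.IsCoP p) (h : K ≤ L) (hL : L.Normal) : L.IsCoP p := by
  have := hK.finiteIndex
  refine ⟨hL, finiteIndex_of_le h, fun g => ?_⟩
  obtain ⟨k, hk⟩ := hK.pow_mem g
  exact ⟨k, h hk⟩

theorem comap {L : Subgroup F} (hL : L.IsCoP p) (f : E →* F) : (L.comap f).IsCoP p := by
  obtain ⟨_, _, hL⟩ := hL
  refine ⟨inferInstance, ⟨?_⟩, fun g => ?_⟩
  · rw [index_comap]
    exact fun h => FiniteIndex.index_ne_zero (index_eq_zero_of_relIndex_eq_zero h)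
  · obtain ⟨k, hk⟩ := hL (f g)
    exact ⟨k, by simpa using hk⟩

theorem map {L : Subgroup E} (hL : L.IsCoP p) {f : E →* F} (hf : Function.Surjective f) :
    (L.map f).IsCoP p := by
  obtain ⟨hn, hi, hL⟩ := hL
  refine ⟨hn.map f hf, ⟨?_⟩, fun g => ?_⟩
  · exact fun h => hi.index_ne_zero (Nat.eq_zero_of_zero_dvd (h ▸ index_map_dvd L hf))
  · obtain ⟨g, rfl⟩ := hf g
    obtain ⟨k, hk⟩ := hL g
    exact ⟨k, by rw [← map_pow]; exact mem_map_of_mem f hk⟩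

theorem ker [Finite E] (hE : IsPGroup p E) (f : F →* E) : f.ker.IsCoP p := by
  refine ⟨inferInstance, inferInstance, fun g => ?_⟩
  obtain ⟨k, hk⟩ := hE (f g)
  exact ⟨k, by simpa [MonoidHom.mem_ker] using hk⟩

theorem isPGroup_quotient {L : Subgroup F} [L.Normal] (hL : L.IsCoP p) : IsPGroup p (F ⧸ L) := by
  intro g
  obtain ⟨g, rfl⟩ := QuotientGroup.mk_surjective g
  obtain ⟨k, hk⟩ := hL.pow_mem g
  exact ⟨k, by rw [← QuotientGroup.mk_pow, QuotientGroup.eq_one_iff]; exact hk⟩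

/-- If each element of a finite set avoids some co-`p` subgroup, then a single co-`p` subgroup
avoids them all. -/
theorem exists_disjoint {T : Set F} (hT : T.Finite)
    (h : ∀ g ∈ T, ∃ L : Subgroup F, L.IsCoP p ∧ g ∉ L) :
    ∃ L : Subgroup F, L.IsCoP p ∧ ∀ g ∈ T, g ∉ L := by
  induction T, hT using Set.Finite.induction_on with
  | empty => exact ⟨⊤, top, by simp⟩
  | @insert a T _ _ ih =>
    obtain ⟨L, hL, hLT⟩ := ih fun g hg => h g (Set.mem_insert_of_mem _ hg)
    obtain ⟨K, hK, haK⟩ := h a (Set.mem_insert _ _)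
    refine ⟨K ⊓ L, hK.inf hL, ?_⟩
    rintro g (rfl | hg) hgKL
    · exact haK hgKL.1
    · exact hLT g hg hgKL.2

end Subgroup.IsCoP

namespace FreeGroup

section Occurrences

variable {α M : Type*} [Group M]

open Classical in
/-- The number of factorisations `L = A ++ a :: B` in which the image of `A` under `φ` is `m`. -/
noncomputable def occurrences (φ : FreeGroup α →* M) (a : α × Bool) : M → List (α × Bool) → ℕ
  | _, [] => 0
  | m, b :: L => (if b = a ∧ m = 1 then 1 else 0) + occurrences φ a ((φ (mk [b]))⁻¹ * m) L

theorem mk_cons (b : α × Bool) (L : List (α × Bool)) : mk (b :: L) = mk [b] * mk L := by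
  rw [mul_mk]; rfl

theorem occurrences_le_length (φ : FreeGroup α →* M) (a : α × Bool) (m : M)
    (L : List (α × Bool)) : occurrences φ a m L ≤ L.length := by
  induction L generalizing m with
  | nil => simp [occurrences]
  | cons b L ih =>
    have := ih ((φ (mk [b]))⁻¹ * m)
    simp only [occurrences, List.length_cons]
    split_ifs <;> omega

theorem occurrences_ne_zero_iff {φ : FreeGroup α →* M} {a : α × Bool} {m : M}
    {L : List (α × Bool)} :
    occurrences φ a m L ≠ 0 ↔ ∃ A B, L = A ++ a :: B ∧ φ (mk A) = m := by
  induction L generalizing m with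
  | nil => simp [occurrences]
  | cons b L ih =>
    have key : occurrences φ a m (b :: L) ≠ 0 ↔
        (b = a ∧ m = 1) ∨ occurrences φ a ((φ (mk [b]))⁻¹ * m) L ≠ 0 := by
      simp only [occurrences]
      split_ifs with h <;> simp [h]
    rw [key, ih]
    constructor
    · rintro (⟨rfl, rfl⟩ | ⟨A, B, rfl, h⟩)
      · exact ⟨[], L, rfl, by simp [← one_eq_mk]⟩
      · refine ⟨b :: A, B, rfl, ?_⟩
        rw [mk_cons, _root_.map_mul, h, mul_inv_cancel_left]
    · rintro ⟨A, B, h, rfl⟩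
      cases A with
      | nil =>
        simp only [List.nil_append, List.cons.injEq] at h
        exact Or.inl ⟨h.1, by simp [← one_eq_mk]⟩
      | cons c A =>
        simp only [List.cons_append, List.cons.injEq] at h
        obtain ⟨rfl, rfl⟩ := h
        refine Or.inr ⟨A, B, rfl, ?_⟩
        rw [mk_cons b A, _root_.map_mul, inv_mul_cancel_left]

open Classical in
/-- The homomorphism to the wreath product `ZMod q ≀ M` that records, besides `φ`, how often the
path of a word in the Cayley graph of `M` traverses the edges labelled `a`, counted with sign. -/
noncomputable def traversalHom (φ : FreeGroup α →* M) (a : α × Bool) (q : ℕ) :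
    FreeGroup α →* RegularWreathProduct (Multiplicative (ZMod q)) M :=
  lift fun s => ⟨fun m => Multiplicative.ofAdd
    ((if (s, true) = a ∧ m = 1 then 1 else 0) -
      (if (s, true) = (a.1, !a.2) ∧ m * φ (mk [a]) = 1 then 1 else 0)), φ (of s)⟩

theorem traversalHom_right (φ : FreeGroup α →* M) (a : α × Bool) (q : ℕ) (g : FreeGroup α) :
    (traversalHom φ a q g).right = φ g := by
  have : RegularWreathProduct.rightHom.comp (traversalHom φ a q) = φ := by
    ext s
    simp [traversalHom, RegularWreathProduct.rightHom_eq_right]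
  exact DFunLike.congr_fun this g

open Classical in
theorem traversalHom_left_letter (φ : FreeGroup α →* M) (a b : α × Bool) (q : ℕ) (m : M) :
    (traversalHom φ a q (mk [b])).left m = Multiplicative.ofAdd
      ((if b = a ∧ m = 1 then 1 else 0) -
        (if b = (a.1, !a.2) ∧ m * φ (mk [a]) = 1 then 1 else 0)) := by
  obtain ⟨s, _ | _⟩ := b
  · have hs : mk [(s, false)] = (of s)⁻¹ := rfl
    rw [hs, _root_.map_inv]
    simp only [traversalHom, lift_apply_of, RegularWreathProduct.inv_left, Pi.inv_apply,
      ← ofAdd_neg, neg_sub]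
    congr 2
    · obtain ⟨t, _ | _⟩ := a
      · have ht : mk [(t, false)] = (of t)⁻¹ := rfl
        by_cases h : s = t
        · subst h
          simp [ht, mul_assoc, mul_eq_one_iff_eq_inv]
        · simp [h]
      · simp
    · obtain ⟨t, _ | _⟩ := a
      · simp
      · have ht : mk [(t, true)] = of t := rfl
        by_cases h : s = t
        · subst h
          simp [ht, mul_eq_one_comm (a := m)]
        · simp [h]
  · have hs : mk [(s, true)] = of s := rfl
    simp [hs, traversalHom]

theorem traversalHom_left (φ : FreeGroup α →* M) (a : α × Bool) (q : ℕ) (L : List (α × Bool))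
    (m : M) :
    (traversalHom φ a q (mk L)).left m = Multiplicative.ofAdd
      ((occurrences φ a m L : ZMod q) -
        occurrences φ (a.1, !a.2) (m * φ (mk [a])) L) := by
  induction L generalizing m with
  | nil => simp [occurrences, ← one_eq_mk]
  | cons b L ih =>
    rw [mk_cons, _root_.map_mul, RegularWreathProduct.mul_left, Pi.mul_apply, traversalHom_left_letter, ih,
      traversalHom_right, ← ofAdd_add]
    simp only [occurrences, Nat.cast_add, Nat.cast_ite, Nat.cast_one, Nat.cast_zero, mul_assoc]
    congr 1
    ring

end Occurrences

theorem isPGroup_wreath {M : Type*} [Group M] [Finite M] {p : ℕ} (hp : p.Prime)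
    (hM : IsPGroup p M) (k : ℕ) :
    IsPGroup p (RegularWreathProduct (Multiplicative (ZMod (p ^ k))) M) := by
  have := Fact.mk hp
  obtain ⟨n, hn⟩ := IsPGroup.iff_card.mp hM
  refine IsPGroup.of_card (n := k * Nat.card M + n) ?_
  rw [RegularWreathProduct.card, Nat.card_congr Multiplicative.toAdd, Nat.card_zmod, pow_add,
    ← pow_mul, ← hn]

end FreeGroup
namespace FreeGroup

variable {α : Type*}

theorem exists_isCoP_notMem [DecidableEq α] {p : ℕ} (hp : p.Prime) {w : FreeGroup α} (hw : w ≠ 1) :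
    ∃ L : Subgroup (FreeGroup α), L.IsCoP p ∧ w ∉ L := by
  induction hn : w.norm using Nat.strong_induction_on generalizing w with
  | _ n ih =>
  subst hn
  have hred : IsReduced w.toWord := isReduced_toWord
  have hne : w.toWord ≠ [] := by simpa using hw
  obtain ⟨a, W, hW⟩ := List.exists_cons_of_ne_nil hne
  have hwW : w = mk (a :: W) := by rw [← hW, mk_toWord]
  have hnorm : w.norm = W.length + 1 := by rw [norm, hW]; rfl
  have reduced_norm {A : List (α × Bool)} (hA : IsReduced A) : (mk A).norm = A.length := by
    rw [norm, toWord_mk, hA.reduce_eq]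
  have ne_one {A : List (α × Bool)} (hA : IsReduced A) (h : A ≠ []) : mk A ≠ 1 := by
    intro h1
    have := norm_eq_zero.mpr h1
    rw [reduced_norm hA] at this
    exact h (List.length_eq_zero_iff.mp this)
  by_cases hend : ∃ V, W = V ++ [(a.1, !a.2)]
  · obtain ⟨V, rfl⟩ := hend
    have hwV : w = mk [a] * mk V * (mk [a])⁻¹ := by
      rw [hwW, inv_mk, mul_mk, mul_mk]; rfl
    have hV : IsReduced V := hred.infix (hW ▸ ⟨[a], [(a.1, !a.2)], by simp⟩)
    have hV1 : mk V ≠ 1 := by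
      rintro h
      rw [h] at hwV
      exact hw (by rw [hwV, mul_one, mul_inv_cancel])
    obtain ⟨L, hL, hVL⟩ := ih _ (by rw [reduced_norm hV, hnorm, List.length_append]; simp)
      hV1 rfl
    refine ⟨L, hL, fun h => hVL ?_⟩
    have := hL.normal.conj_mem _ h (mk [a])⁻¹
    have e : (mk [a])⁻¹ * w * (mk [a])⁻¹⁻¹ = mk V := by rw [hwV]; group
    rwa [e] at this
  · obtain ⟨K, hK, hKT⟩ := Subgroup.IsCoP.exists_disjoint (p := p)
      (T := mk '' {A | A ∈ w.toWord.inits ∧ A ≠ [] ∧ A ≠ w.toWord})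
      (((List.finite_toSet _).subset fun A h => h.1).image _) (by
        rintro _ ⟨A, ⟨hA, hA0, hAW⟩, rfl⟩
        rw [List.mem_inits] at hA
        have hAr : IsReduced A := hred.infix hA.isInfix
        refine ih _ ?_ (ne_one hAr hA0) rfl
        rw [reduced_norm hAr, norm]
        exact lt_of_le_of_ne hA.length_le fun h => hAW (hA.eq_of_length h))
    have := hK.normal
    have := hK.finiteIndex
    have hproper {A B : List (α × Bool)} (h : a :: W = A ++ B)
        (hA1 : QuotientGroup.mk' K (mk A) = 1) (hB : B ≠ []) : A = [] := by
      by_contra hA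
      refine hKT _ ⟨A, ⟨?_, hA, ?_⟩, rfl⟩ ((QuotientGroup.eq_one_iff _).mp hA1)
      · rw [hW, h]; simp
      · rw [hW, h]; simpa using Ne.symm hB
    obtain ⟨k, hk⟩ : ∃ k, (a :: W).length < p ^ k := ⟨_, Nat.lt_pow_self hp.one_lt⟩
    have : NeZero (p ^ k) := ⟨(pow_pos hp.pos k).ne'⟩
    have : Finite (Multiplicative (ZMod (p ^ k))) := inferInstanceAs (Finite (ZMod (p ^ k)))
    refine ⟨_, .ker (isPGroup_wreath hp hK.isPGroup_quotient k)
      (traversalHom (QuotientGroup.mk' K) a (p ^ k)), fun hker => ?_⟩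
    have h1 := congrArg (fun x => Multiplicative.toAdd (x.left 1)) (MonoidHom.mem_ker.mp hker)
    have hneg : occurrences (QuotientGroup.mk' K) (a.1, !a.2)
        (1 * QuotientGroup.mk' K (mk [a])) (a :: W) = 0 := by
      by_contra h
      obtain ⟨A, B, hAB, hA⟩ := occurrences_ne_zero_iff.mp h
      have hA1 : QuotientGroup.mk' K (mk (A ++ [(a.1, !a.2)])) = 1 := by
        have : mk [(a.1, !a.2)] = (mk [a])⁻¹ := by rw [inv_mk]; rfl
        rw [← mul_mk, _root_.map_mul, hA, this, _root_.map_inv, one_mul, mul_inv_cancel]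
      by_cases hB : B = []
      · subst hB
        cases A with
        | nil =>
          simp only [List.nil_append, List.cons.injEq] at hAB
          have := congrArg Prod.snd hAB.1
          simp at this
        | cons c A =>
          simp only [List.cons_append, List.cons.injEq] at hAB
          exact hend ⟨A, hAB.2⟩
      · simpa using hproper (A := A ++ [(a.1, !a.2)]) (B := B) (by simp [hAB]) hA1 hB
    have hpos : occurrences (QuotientGroup.mk' K) a 1 (a :: W) ≠ 0 :=
      occurrences_ne_zero_iff.mpr ⟨[], W, rfl, by simp [← one_eq_mk]⟩
    rw [hwW, traversalHom_left, hneg] at h1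
    simp only [toAdd_ofAdd, Nat.cast_zero, sub_zero, RegularWreathProduct.one_left, Pi.one_apply,
      toAdd_one] at h1
    rw [ZMod.natCast_eq_zero_iff] at h1
    exact hpos (Nat.eq_zero_of_dvd_of_lt h1 ((occurrences_le_length _ _ _ _).trans_lt hk))

theorem flatten_replicate_eq_append_cons {β : Type*} {U A B : List β} {b : β} {n : ℕ}
    (h : (List.replicate n U).flatten = A ++ b :: B) :
    ∃ c A' B', A = (List.replicate c U).flatten ++ A' ∧ U = A' ++ b :: B' := by
  induction n generalizing A with
  | zero => simp at h
  | succ n ih =>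
    rw [List.replicate_succ, List.flatten_cons, List.append_eq_append_iff] at h
    obtain ⟨C, rfl, h⟩ | ⟨C, rfl, h⟩ := h
    · obtain ⟨c, A', B', rfl, hU⟩ := ih h
      exact ⟨c + 1, A', B', by simp [List.replicate_succ], hU⟩
    · cases C with
      | nil =>
        obtain ⟨c, A', B', hA', hU⟩ := ih (A := []) (by simpa using h.symm)
        have : A' = [] := by simp at hA'; exact hA'.2
        subst this
        exact ⟨1, [], B', by simp, hU⟩
      | cons d C =>
        simp only [List.cons_append, List.cons.injEq] at h
        obtain ⟨rfl, -⟩ := h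
        exact ⟨0, A, C, by simp, rfl⟩

theorem IsCyclicallyReduced.isReduced_rotate {A B : List (α × Bool)}
    (h : IsCyclicallyReduced (A ++ B)) : IsReduced (B ++ A) := by
  have := (h.flatten_replicate 2).isReduced
  exact this.infix ⟨A, B, by simp [List.replicate_succ]⟩

theorem IsReduced.mk_injOn [DecidableEq α] {A B : List (α × Bool)} (hA : IsReduced A)
    (hB : IsReduced B) (h : mk A = mk B) : A = B := by
  rw [← hA.reduce_eq, ← hB.reduce_eq, reduce.sound h]

/-- A conjugator modulo a sufficiently small co-`p` subgroup can be corrected, modulo a given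
co-`p` subgroup, to an actual conjugator; the case of a cyclically reduced source. -/
theorem exists_isCoP_conj_of_isCyclicallyReduced [DecidableEq α] {p : ℕ} (hp : p.Prime)
    {a : α × Bool} {U : List (α × Bool)} (hU : IsCyclicallyReduced (a :: U)) (v : FreeGroup α)
    {K : Subgroup (FreeGroup α)} (hK : K.IsCoP p) :
    ∃ L : Subgroup (FreeGroup α), L.IsCoP p ∧ ∀ g, g * mk (a :: U) * g⁻¹ * v⁻¹ ∈ L →
      ∃ k ∈ K, (g * k) * mk (a :: U) * (g * k)⁻¹ = v := by
  set u := mk (a :: U) with hu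
  set V := v.toWord with hV
  have hv : mk V = v := mk_toWord
  obtain ⟨K', hK', hKT⟩ := Subgroup.IsCoP.exists_disjoint (p := p)
    (T := {g | g ≠ 1 ∧ g ∈ ((fun P => mk P * u * (mk P)⁻¹ * u⁻¹) '' {P | P ∈ (a :: U).inits}) ∪
      ((fun P => u⁻¹ * ((mk P)⁻¹ * v * mk P)) '' {P | P ∈ V.inits})})
    ((((List.finite_toSet _).image _).union ((List.finite_toSet _).image _)).subset
      fun g hg => hg.2) fun g hg => exists_isCoP_notMem hp hg.1
  have hKK := hK'.inf hK
  have := hKK.normal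
  have := hKK.finiteIndex
  set φ := QuotientGroup.mk' (K' ⊓ K) with hφ
  have mem_of_eq_one {g : FreeGroup α} (h : φ g = 1) : g ∈ K' ⊓ K :=
    (QuotientGroup.eq_one_iff _).mp h
  have hcomm {P Q : List (α × Bool)} (h : a :: U = P ++ Q) (hP : Commute (φ (mk P)) (φ u)) :
      Q ++ P = a :: U := by
    have h1 : mk P * u * (mk P)⁻¹ * u⁻¹ = 1 := by
      by_contra hne
      refine hKT _ ⟨hne, Or.inl ⟨P, ?_, rfl⟩⟩ (mem_of_eq_one ?_).1
      · rw [Set.mem_ofPred_eq, List.mem_inits, h]; simp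
      · simp only [_root_.map_mul, _root_.map_inv]
        rw [hP.eq]; group
    refine (h ▸ hU).isReduced_rotate.mk_injOn hU.isReduced ?_
    have h2 : mk P * u = u * mk P := by rw [mul_inv_eq_one, mul_inv_eq_iff_eq_mul] at h1; exact h1
    have h3 : u = mk P * mk Q := by rw [hu, h, mul_mk]
    rw [← hu, ← mul_mk]
    apply mul_left_cancel (a := mk P)
    rw [h2, ← mul_assoc, ← h3]
  have o_pos : 0 < Nat.card (FreeGroup α ⧸ K' ⊓ K) := Nat.card_pos
  have pow_o (x : FreeGroup α ⧸ K' ⊓ K) : x ^ Nat.card (FreeGroup α ⧸ K' ⊓ K) = 1 :=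
    pow_card_eq_one'
  set o := Nat.card (FreeGroup α ⧸ K' ⊓ K) with ho
  set Uo := (List.replicate o (a :: U)).flatten with hUo
  set Vo := (List.replicate o V).flatten with hVo
  obtain ⟨k, hk⟩ : ∃ k, Uo.length + Vo.length < p ^ k := ⟨_, Nat.lt_pow_self hp.one_lt⟩
  have : NeZero (p ^ k) := ⟨(pow_pos hp.pos k).ne'⟩
  have : Finite (Multiplicative (ZMod (p ^ k))) := inferInstanceAs (Finite (ZMod (p ^ k)))
  refine ⟨_, .ker (isPGroup_wreath hp hKK.isPGroup_quotient k) (traversalHom φ a (p ^ k)),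
    fun g hg => ?_⟩
  set Φ := traversalHom φ a (p ^ k) with hΦ
  have hright (x : FreeGroup α) : (Φ x).right = φ x := traversalHom_right _ _ _ _
  have hΦg : Φ g * Φ u * (Φ g)⁻¹ = Φ v := by
    rw [MonoidHom.mem_ker] at hg
    simpa only [_root_.map_mul, _root_.map_inv, mul_inv_eq_one] using hg
  have hφg : φ g * φ u * (φ g)⁻¹ = φ v := by
    simpa [hright] using congrArg RegularWreathProduct.right hΦg
  have hpow : Φ g * Φ (mk Uo) = Φ (mk Vo) * Φ g := by
    rw [← pow_mk, ← pow_mk, _root_.map_pow, _root_.map_pow, hv, ← hΦg, conj_pow,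
      inv_mul_cancel_right]
  have hVo1 : φ (mk Vo) = 1 := by rw [← pow_mk, _root_.map_pow]; exact pow_o _
  have hleft := congrArg (fun x => Multiplicative.toAdd (x.left (φ g))) hpow
  simp only [RegularWreathProduct.mul_left, Pi.mul_apply, hright, hVo1, inv_one, one_mul,
    inv_mul_cancel, toAdd_mul] at hleft
  rw [add_comm, add_right_cancel_iff, hΦ, traversalHom_left, traversalHom_left] at hleft
  have hneg : occurrences φ (a.1, !a.2) (1 * φ (mk [a])) Uo = 0 := by
    by_contra h
    obtain ⟨A, B, hAB, hA⟩ := occurrences_ne_zero_iff.mp h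
    obtain ⟨c, A', B', rfl, hU'⟩ := flatten_replicate_eq_append_cons hAB
    have hPcomm : Commute (φ (mk (A' ++ [(a.1, !a.2)]))) (φ u) := by
      have h1 : φ u ^ c * φ (mk (A' ++ [(a.1, !a.2)])) = 1 := by
        have : mk [(a.1, !a.2)] = (mk [a])⁻¹ := by rw [inv_mk]; rfl
        rw [one_mul, ← mul_mk, ← pow_mk, _root_.map_mul, _root_.map_pow] at hA
        rw [← mul_mk, _root_.map_mul, ← mul_assoc, hA, this, _root_.map_inv, mul_inv_cancel]
      rw [eq_inv_of_mul_eq_one_right h1]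
      exact ((Commute.refl (φ u)).pow_left c).inv_left
    have hrot := hcomm (P := A' ++ [(a.1, !a.2)]) (Q := B') (by simp [hU']) hPcomm
    have := hU.2 (a.1, !a.2) (by rw [← hrot, ← List.append_assoc]; simp) a (by simp) rfl
    simp at this
  have hpos : occurrences φ a 1 Uo ≠ 0 :=
    occurrences_ne_zero_iff.mpr ⟨[], U ++ (List.replicate (o - 1) (a :: U)).flatten, by
      obtain ⟨o', ho'⟩ := Nat.exists_eq_add_one.mpr o_pos
      rw [hUo, ho']; simp [List.replicate_succ], by simp [← one_eq_mk]⟩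
  rw [hneg] at hleft
  have hVpos : occurrences φ a (φ g) Vo ≠ 0 := by
    intro h0
    rw [h0] at hleft
    simp only [Nat.cast_zero, sub_zero, zero_sub, toAdd_ofAdd, eq_neg_iff_add_eq_zero] at hleft
    rw [← Nat.cast_add, ZMod.natCast_eq_zero_iff] at hleft
    have h1 := occurrences_le_length φ a 1 Uo
    have h2 := occurrences_le_length φ (a.1, !a.2) (φ g * φ (mk [a])) Vo
    have := Nat.eq_zero_of_dvd_of_lt hleft (by omega)
    omega
  obtain ⟨A, B, hAB, hA⟩ := occurrences_ne_zero_iff.mp hVpos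
  obtain ⟨c, A', B', rfl, hV'⟩ := flatten_replicate_eq_append_cons hAB
  set g' := mk ((List.replicate c V).flatten ++ A') with hg'
  have hg'eq : g' = v ^ c * mk A' := by rw [hg', ← mul_mk, ← pow_mk, hv]
  refine ⟨g⁻¹ * g', (mem_of_eq_one (by simp [hA])).2, ?_⟩
  have hconj : u⁻¹ * ((mk A')⁻¹ * v * mk A') = 1 := by
    by_contra hne
    refine hKT _ ⟨hne, Or.inr ⟨A', ?_, rfl⟩⟩ (mem_of_eq_one ?_).1
    · rw [Set.mem_ofPred_eq, List.mem_inits, hV']; simp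
    · have h1 : (mk A')⁻¹ * v * mk A' = g'⁻¹ * v * g' := by
        rw [hg'eq]
        group
      rw [h1]
      simp only [_root_.map_mul, _root_.map_inv, hA, ← hφg]
      group
  have hu' : u = (mk A')⁻¹ * v * mk A' := inv_mul_eq_one.mp hconj
  rw [mul_inv_cancel_left, hu', hg'eq]
  have : Commute (v ^ c) v := (Commute.refl v).pow_left c
  calc _ = v ^ c * v * (v ^ c)⁻¹ := by group
    _ = v := by rw [this.eq]; group

theorem exists_conj_isCyclicallyReduced [DecidableEq α] (u : FreeGroup α) :
    ∃ (c : FreeGroup α) (U : List (α × Bool)), IsCyclicallyReduced U ∧ u = c * mk U * c⁻¹ := by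
  refine ⟨mk (reduceCyclically.conjugator u.toWord), reduceCyclically u.toWord,
    reduceCyclically.isCyclicallyReduced isReduced_toWord, ?_⟩
  rw [inv_mk, mul_mk, mul_mk, reduceCyclically.conj_conjugator_reduceCyclically, mk_toWord]

/-- A conjugator modulo a sufficiently small co-`p` subgroup can be corrected, modulo a given
co-`p` subgroup, to an actual conjugator. -/
theorem exists_isCoP_conj {p : ℕ} (hp : p.Prime) (u v : FreeGroup α)
    {K : Subgroup (FreeGroup α)} (hK : K.IsCoP p) :
    ∃ L : Subgroup (FreeGroup α), L.IsCoP p ∧ ∀ g, g * u * g⁻¹ * v⁻¹ ∈ L →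
      ∃ k ∈ K, (g * k) * u * (g * k)⁻¹ = v := by
  classical
  obtain ⟨c, U, hU, rfl⟩ := exists_conj_isCyclicallyReduced u
  cases U with
  | nil =>
    by_cases hv : v = 1
    · exact ⟨K, hK, fun g _ => ⟨1, K.one_mem, by simp [hv, ← one_eq_mk]⟩⟩
    · obtain ⟨L, hL, hvL⟩ := exists_isCoP_notMem hp hv
      exact ⟨L, hL, fun g hg => (hvL (by simpa [← one_eq_mk] using hg)).elim⟩
  | cons a U =>
    obtain ⟨L, hL, h⟩ := exists_isCoP_conj_of_isCyclicallyReduced hp hU v hK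
    refine ⟨L, hL, fun g hg => ?_⟩
    obtain ⟨k, hk, hkv⟩ := h (g * c) (by simpa [mul_assoc] using hg)
    refine ⟨c * k * c⁻¹, hK.normal.conj_mem _ hk _, ?_⟩
    rw [← hkv]
    group

end FreeGroup

namespace FreeGroup

variable {α : Type*}

theorem subsingleton_of_mem_center {z : FreeGroup α} (hz : z ≠ 1)
    (h : z ∈ Subgroup.center (FreeGroup α)) : Subsingleton α := by
  classical
  by_contra hα
  rw [not_subsingleton_iff_nontrivial] at hα
  have hred : IsReduced z.toWord := isReduced_toWord
  have hne : z.toWord ≠ [] := by simpa using hz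
  obtain ⟨a, W, hW⟩ := List.exists_cons_of_ne_nil hne
  obtain ⟨V, b, hV⟩ := List.eq_nil_or_concat' z.toWord |>.resolve_left hne
  obtain ⟨x, hx⟩ := exists_ne a.1
  obtain ⟨t, hta, htb⟩ : ∃ t : α × Bool, t.1 ≠ a.1 ∧ (b.1 = t.1 → b.2 = t.2) :=
    ⟨(x, b.2), hx, fun _ => rfl⟩
  have h1 : IsReduced (t :: z.toWord) := by
    rw [hW] at hred ⊢
    exact isReduced_cons_cons.mpr ⟨fun h => (hta h).elim, hred⟩
  have h2 : IsReduced (z.toWord ++ [t]) := by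
    refine List.isChain_append.mpr ⟨hred, by simp, ?_⟩
    rw [hV]
    simpa using htb
  have h3 : t :: z.toWord = z.toWord ++ [t] := by
    refine h1.mk_injOn h2 ?_
    rw [mk_cons, ← mul_mk, mk_toWord]
    exact Subgroup.mem_center_iff.mp h _
  rw [hW] at h3
  simp only [List.cons_append, List.cons.injEq] at h3
  exact hta (congrArg Prod.fst h3.1)

theorem isCyclic_of_subsingleton_generators [Subsingleton α] : IsCyclic (FreeGroup α) := by
  cases isEmpty_or_nonempty α with
  | inl _ => exact isCyclic_of_subsingleton
  | inr h =>
    obtain ⟨a⟩ := h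
    have : Unique α := uniqueOfSubsingleton a
    exact mulEquivIntOfUnique.isCyclic.mpr inferInstance

theorem isCyclic_centralizer {f : FreeGroup α} (hf : f ≠ 1) :
    IsCyclic (Subgroup.centralizer ({f} : Set (FreeGroup α))) := by
  have := subgroupIsFreeOfIsFree (Subgroup.centralizer ({f} : Set (FreeGroup α)))
  set e := IsFreeGroup.toFreeGroup (Subgroup.centralizer ({f} : Set (FreeGroup α)))
  let z : Subgroup.centralizer ({f} : Set (FreeGroup α)) :=
    ⟨f, by simp [Subgroup.mem_centralizer_iff]⟩
  have hz : z ≠ 1 := fun h => hf (congrArg Subtype.val h)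
  have : Subsingleton (IsFreeGroup.Generators
      (Subgroup.centralizer ({f} : Set (FreeGroup α)))) := by
    refine subsingleton_of_mem_center (z := e z) (by simpa using hz) ?_
    rw [Subgroup.mem_center_iff]
    intro g
    obtain ⟨c, rfl⟩ := e.surjective g
    rw [← _root_.map_mul, ← _root_.map_mul]
    congr 1
    exact Subtype.ext (Subgroup.mem_centralizer_singleton_iff.mp c.2)
  exact e.isCyclic.mpr isCyclic_of_subsingleton_generators

theorem exists_forall_commute_mem_zpowers {f : FreeGroup α} (hf : f ≠ 1) :
    ∃ r : FreeGroup α, Commute r f ∧ ∀ c, Commute c f → c ∈ Subgroup.zpowers r := by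
  obtain ⟨⟨r, hr⟩, h⟩ := (isCyclic_centralizer hf).exists_generator
  refine ⟨r, Subgroup.mem_centralizer_singleton_iff.mp hr, fun c hc => ?_⟩
  obtain ⟨n, hn⟩ := h ⟨c, Subgroup.mem_centralizer_singleton_iff.mpr hc⟩
  exact ⟨n, congrArg Subtype.val hn⟩

theorem append_comm_of_append_flatten_replicate_eq {β : Type*} {A W R : List β} {m k : ℕ}
    (hA : A.length ≤ m * W.length)
    (h : A ++ (List.replicate (m + 2) W).flatten = (List.replicate (k + 2) R).flatten) :
    R ++ W = W ++ R := by
  have flatten_succ (n : ℕ) (B : List β) :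
      (List.replicate (n + 1) B).flatten = (List.replicate n B).flatten ++ B := by
    simp [List.replicate_succ']
  have len (n : ℕ) (B : List β) : (List.replicate n B).flatten.length = n * B.length := by simp
  have hlen := congrArg List.length h
  rw [List.length_append, len, len] at hlen
  set L := (List.replicate (k + 2) R).flatten with hL
  have hWL : (List.replicate (m + 2) W).flatten <:+ L := ⟨A, h⟩
  have hRL : R <:+ L := ⟨_, (flatten_succ _ _).symm⟩
  have hWL' : W <:+ L := List.IsSuffix.trans ⟨_, (flatten_succ _ _).symm⟩ hWL
  have h1 : R <:+ (List.replicate (m + 1) W).flatten := by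
    refine List.suffix_of_suffix_length_le hRL
      (List.IsSuffix.trans ⟨W, ?_⟩ hWL) ?_
    · simp [List.replicate_succ]
    · rw [len]; nlinarith
  have h2 : W <:+ (List.replicate (k + 1) R).flatten := by
    refine List.suffix_of_suffix_length_le hWL' ⟨R, ?_⟩ ?_
    · simp [hL, List.replicate_succ]
    · rw [len]; nlinarith
  have h3 : R ++ W <:+ L := by
    refine List.IsSuffix.trans ?_ hWL
    rw [flatten_succ]
    exact (List.suffix_append_inj_of_length_eq rfl).mpr ⟨h1, rfl⟩
  have h4 : W ++ R <:+ L := by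
    rw [hL, flatten_succ]
    exact (List.suffix_append_inj_of_length_eq rfl).mpr ⟨h2, rfl⟩
  exact (List.suffix_of_suffix_length_le h3 h4 (by simp [add_comm])).eq_of_length
    (by simp [add_comm])

theorem commute_of_isCyclicallyReduced_of_eq_pow [DecidableEq α] {A W : List (α × Bool)}
    {r : FreeGroup α} {m k : ℕ} (hA : A.length ≤ m * W.length)
    (hL : IsCyclicallyReduced (A ++ (List.replicate (m + 2) W).flatten))
    (h : mk (A ++ (List.replicate (m + 2) W).flatten) = r ^ (k + 2)) :
    Commute r (mk W) := by
  have hword := congrArg toWord h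
  rw [toWord_mk, hL.isReduced.reduce_eq, toWord_pow,
    reduceCyclically.reduce_flatten_replicate isReduced_toWord, if_neg (by omega)] at hword
  cases hc : reduceCyclically.conjugator r.toWord with
  | nil =>
    have hr := reduceCyclically.conj_conjugator_reduceCyclically r.toWord
    simp only [hc, List.nil_append, invRev_empty, List.append_nil] at hr hword
    rw [hr] at hword
    have := append_comm_of_append_flatten_replicate_eq hA hword
    have := congrArg (mk (α := α)) this
    rwa [← mul_mk, ← mul_mk, mk_toWord] at this
  | cons a C =>
    rw [hc] at hword
    have := hL.2 (a.1, !a.2) (by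
      rw [hword]
      simp only [invRev, List.map_cons, List.reverse_cons, ← List.append_assoc,
        List.getLast?_concat]
      rfl) a (by simp [hword]) rfl
    simp at this

theorem exists_pair_of_letters [Nontrivial α] {a b c d : α × Bool}
    (hcd : d.1 = c.1 → d.2 = c.2) :
    ∃ s t : α × Bool, s ≠ t ∧ (s.1 = a.1 → s.2 = a.2) ∧ s ≠ b ∧ (t.1 = a.1 → t.2 = a.2) ∧ t ≠ b ∧
      (d.1 = s.1 → d.2 = s.2) ∧ t ≠ c := by
  classical
  obtain ⟨x, y, hxy⟩ := exists_pair_ne α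
  have hcard : 1 < (({(x, true), (x, false), (y, true), (y, false)} : Finset (α × Bool)) \
      {(a.1, !a.2), b}).card := by
    have h4 : ({(x, true), (x, false), (y, true), (y, false)} : Finset (α × Bool)).card = 4 := by
      simp [hxy]
    have h2 := Finset.card_le_two (a := (a.1, !a.2)) (b := b)
    have := Finset.le_card_sdiff {(a.1, !a.2), b}
      ({(x, true), (x, false), (y, true), (y, false)} : Finset (α × Bool))
    omega
  obtain ⟨s, hs, t, ht, hst⟩ := Finset.one_lt_card.mp hcard
  have key {u : α × Bool} (hu : u ∈ (({(x, true), (x, false), (y, true), (y, false)} :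
      Finset (α × Bool)) \ {(a.1, !a.2), b})) : (u.1 = a.1 → u.2 = a.2) ∧ u ≠ b := by
    simp only [Finset.mem_sdiff, Finset.mem_insert, Finset.mem_singleton, not_or] at hu
    refine ⟨fun h => ?_, hu.2.2⟩
    by_contra h'
    exact hu.2.1 (Prod.ext h (Bool.eq_not_of_ne h'))
  have hinv {u : α × Bool} (hu : ¬ (d.1 = u.1 → d.2 = u.2)) : u = (d.1, !d.2) := by
    push Not at hu
    exact Prod.ext hu.1.symm (Bool.eq_not_of_ne hu.2.symm)
  have hc : c ≠ (d.1, !d.2) := by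
    rintro rfl
    simpa using hcd rfl
  by_cases h : (d.1 = s.1 → d.2 = s.2) ∧ t ≠ c
  · exact ⟨s, t, hst, (key hs).1, (key hs).2, (key ht).1, (key ht).2, h⟩
  · refine ⟨t, s, hst.symm, (key ht).1, (key ht).2, (key hs).1, (key hs).2, ?_, ?_⟩
    · by_contra h'
      refine h ⟨?_, ?_⟩
      · by_contra h''
        exact hst ((hinv h'').trans (hinv h').symm)
      · rintro rfl
        exact hc (hinv h')
    · rintro rfl
      refine h ⟨?_, hst.symm⟩
      by_contra h''
      exact hc (hinv h'')

theorem isReduced_conj_append_conj {a b s t : α × Bool} {U V : List (α × Bool)}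
    (hU : IsReduced U) (hV : IsReduced V) (hUa : U.head? = some a) (hVa : V.head? = some a)
    (hUb : U.getLast? = some b) (hVb : V.getLast? = some b) (hst : s ≠ t)
    (hsa : s.1 = a.1 → s.2 = a.2) (hsb : s ≠ b) (hta : t.1 = a.1 → t.2 = a.2) (htb : t ≠ b) :
    IsReduced ((s :: (U ++ [(s.1, !s.2)])) ++ (t :: (V ++ [(t.1, !t.2)]))) := by
  have key {u v : α × Bool} (h : u ≠ v) (h1 : v.1 = u.1) : v.2 = !u.2 :=
    Bool.eq_not_of_ne fun h2 => h (Prod.ext h1.symm h2.symm)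
  have key' {u v : α × Bool} (h : u ≠ v) (h1 : u.1 = v.1) : (!u.2) = v.2 :=
    (key h h1.symm).symm
  simp only [IsReduced, List.isChain_append, List.isChain_cons] at hU hV ⊢
  refine ⟨⟨?_, hU, ?_, ?_⟩, ⟨?_, hV, ?_, ?_⟩, ?_⟩
  · simpa [hUa] using hsa
  · simp
  · simpa [hUb] using key hsb
  · simpa [hVa] using hta
  · simp
  · simpa [hVb] using key htb
  · simpa [List.getLast?_cons] using key' hst

theorem forall_commute_mem_zpowers_of_isCyclicallyReduced {A W : List (α × Bool)}
    (hA0 : A ≠ []) (hW : IsCyclicallyReduced W) (hAW : IsReduced (A ++ W))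
    (hWA : IsReduced (W ++ A)) (h : ¬ Commute (mk A) (mk W)) :
    ∀ c, Commute c (mk A * mk W ^ (A.length + 2)) →
      c ∈ Subgroup.zpowers (mk A * mk W ^ (A.length + 2)) := by
  classical
  have hW0 : W ≠ [] := by
    rintro rfl
    exact h (Commute.one_right _)
  set m := A.length with hm
  have hlen : A.length ≤ m * W.length :=
    Nat.le_mul_of_pos_right _ (List.length_pos_iff.mpr hW0)
  set L := A ++ (List.replicate (m + 2) W).flatten with hL
  have hLx : mk A * mk W ^ (m + 2) = mk L := by rw [pow_mk, mul_mk]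
  have hLred : IsReduced L := by
    have := hW.flatten_replicate (m + 2)
    have h3 : IsReduced (A ++ W ++ []) := by simpa using hAW
    simpa using IsReduced.append_flatten_replicate_append hW h3 (n := m + 2) (by omega)
  have hLcyc : IsCyclicallyReduced L := by
    refine ⟨hLred, ?_⟩
    have h1 : L.getLast? = W.getLast? := by
      have : L = A ++ (List.replicate (m + 1) W).flatten ++ W := by
        simp [hL, List.replicate_succ']
      rw [this, List.getLast?_append_of_ne_nil _ hW0]
    have h2 : L.head? = A.head? := by
      rw [hL, List.head?_append_of_ne_nil _ hA0]
    rw [h1, h2]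
    exact (List.isChain_append.mp hWA).2.2
  rw [hLx]
  have hx1 : mk L ≠ 1 := by
    intro h1
    have := congrArg toWord h1
    rw [toWord_mk, hLred.reduce_eq, toWord_one, hL] at this
    simp [hA0] at this
  obtain ⟨r, hrx, hr⟩ := exists_forall_commute_mem_zpowers hx1
  have key {r : FreeGroup α} {k : ℕ} (hrk : r ^ k = mk L) :
      k = 1 := by
    match k with
    | 0 => exact (hx1 (by rw [← hrk, pow_zero])).elim
    | 1 => rfl
    | k + 2 =>
      have h1 : Commute r (mk W) :=
        commute_of_isCyclicallyReduced_of_eq_pow hlen hLcyc hrk.symm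
      have h2 : Commute (mk L) (mk W) := hrk ▸ h1.pow_left _
      refine (h ?_).elim
      have h3 : mk A = mk L * (mk W ^ (m + 2))⁻¹ := by rw [← hLx, mul_inv_cancel_right]
      rw [h3]
      exact h2.mul_left ((Commute.refl _).pow_left _).inv_left
  obtain ⟨z, hz⟩ := hr _ (Commute.refl (mk L))
  simp only at hz
  have hzr : mk L = r ∨ mk L = r⁻¹ := by
    obtain ⟨k, rfl | rfl⟩ := z.eq_nat_or_neg
    · rw [zpow_natCast] at hz
      rw [key hz, pow_one] at hz
      exact Or.inl hz.symm
    · rw [zpow_neg, zpow_natCast, ← inv_pow] at hz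
      rw [key hz, pow_one] at hz
      exact Or.inr hz.symm
  intro c hc
  have := hr c hc
  obtain h1 | h1 := hzr
  · rwa [h1]
  · rwa [h1, Subgroup.zpowers_inv]

theorem exists_mem_forall_commute_of_isCyclicallyReduced [Nontrivial α]
    {N : Subgroup (FreeGroup α)} [hN : N.Normal] (hN1 : N ≠ ⊥) {A : List (α × Bool)}
    (hA : IsCyclicallyReduced A) (hA0 : A ≠ []) :
    ∃ n ∈ N, ∀ c, Commute c (mk A * n) → c ∈ Subgroup.zpowers (mk A * n) := by
  classical
  obtain ⟨⟨w, hwN⟩, hw⟩ := N.ne_bot_iff_exists_ne_one.mp hN1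
  obtain ⟨g, U, hU, rfl⟩ := exists_conj_isCyclicallyReduced w
  have hUN : mk U ∈ N := by
    have := hN.conj_mem _ hwN g⁻¹
    have e : g⁻¹ * (g * mk U * g⁻¹) * g⁻¹⁻¹ = mk U := by group
    rwa [e] at this
  have hU0 : U ≠ [] := by
    rintro rfl
    exact hw (Subtype.ext (by simp [← one_eq_mk]))
  have hAc := List.head?_eq_some_head hA0
  have hAd := List.getLast?_eq_some_getLast hA0
  have hUa := List.head?_eq_some_head hU0
  have hUb := List.getLast?_eq_some_getLast hU0
  obtain ⟨s, t, hst, hsa, hsb, hta, htb, hsd, htc⟩ := exists_pair_of_letters (a := U.head hU0)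
    (b := U.getLast hU0) (hA.2 _ hAd _ hAc)
  set W : List (α × Bool) → List (α × Bool) := fun V =>
    (s :: (U ++ [(s.1, !s.2)])) ++ (t :: (V ++ [(t.1, !t.2)])) with hWdef
  have mk_conj (u : α × Bool) (V : List (α × Bool)) :
      mk (u :: (V ++ [(u.1, !u.2)])) = mk [u] * mk V * (mk [u])⁻¹ := by
    rw [inv_mk, mul_mk, mul_mk]; rfl
  have main {V : List (α × Bool)} (hV : IsReduced V) (hVN : mk V ∈ N)
      (hVa : V.head? = some (U.head hU0)) (hVb : V.getLast? = some (U.getLast hU0))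
      (h : ¬ Commute (mk A) (mk (W V))) :
      ∃ n ∈ N, ∀ c, Commute c (mk A * n) → c ∈ Subgroup.zpowers (mk A * n) := by
    have hWr : IsReduced (W V) := isReduced_conj_append_conj hU.isReduced hV hUa hVa hUb hVb hst
      hsa hsb hta htb
    have hhead : (W V).head? = some s := rfl
    have hlast : (W V).getLast? = some (t.1, !t.2) := by
      simp only [hWdef, ← List.cons_append, ← List.append_assoc, List.getLast?_concat]
    have hinv {u : α × Bool} (hu : t ≠ u) (h1 : t.1 = u.1) : (!t.2) = u.2 :=
      (Bool.eq_not_of_ne fun h2 => hu (Prod.ext h1 h2.symm)).symm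
    refine ⟨mk (W V) ^ (A.length + 2), N.pow_mem ?_ _,
      forall_commute_mem_zpowers_of_isCyclicallyReduced hA0 ⟨hWr, ?_⟩ ?_ ?_ h⟩
    · rw [hWdef, ← mul_mk, mk_conj, mk_conj]
      exact N.mul_mem (hN.conj_mem _ hUN _) (hN.conj_mem _ hVN _)
    · rw [hhead, hlast]
      simpa using hinv hst.symm
    · refine List.isChain_append.mpr ⟨hA.isReduced, hWr, ?_⟩
      rw [hhead, hAd]
      simpa using hsd
    · refine List.isChain_append.mpr ⟨hWr, hA.isReduced, ?_⟩
      rw [hlast, hAc]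
      simpa using hinv htc
  by_contra hcon
  have hUU : IsReduced (U ++ U) := by
    simpa [List.replicate_succ] using (hU.flatten_replicate 2).isReduced
  have h1 : Commute (mk A) (mk (W U)) := by
    by_contra h
    exact hcon (main hU.isReduced hUN hUa hUb h)
  have h2 : Commute (mk A) (mk (W (U ++ U))) := by
    by_contra h
    refine hcon (main hUU ?_ ?_ ?_ h)
    · rw [← mul_mk]; exact N.mul_mem hUN hUN
    · rw [List.head?_append_of_ne_nil _ hU0, hUa]
    · rw [List.getLast?_append_of_ne_nil _ hU0, hUb]
  set X := mk [s] * mk U * (mk [s])⁻¹ with hX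
  set Y := mk [t] * mk U * (mk [t])⁻¹ with hY
  have e1 : mk (W U) = X * Y := by rw [hWdef, ← mul_mk, mk_conj, mk_conj]
  have e2 : mk (W (U ++ U)) = X * Y * Y := by
    rw [hWdef, ← mul_mk, mk_conj, mk_conj, ← mul_mk, hX, hY]
    group
  have hAY : Commute (mk A) Y := by
    have : Y = (mk (W U))⁻¹ * mk (W (U ++ U)) := by rw [e1, e2]; group
    rw [this]
    exact h1.inv_right.mul_right h2
  have hAX : Commute (mk A) X := by
    have : X = mk (W U) * Y⁻¹ := by rw [e1]; group
    rw [this]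
    exact h1.mul_right hAY.inv_right
  have hA1 : mk A ≠ 1 := by
    intro h
    have := congrArg toWord h
    rw [toWord_mk, hA.isReduced.reduce_eq, toWord_one] at this
    exact hA0 this
  obtain ⟨r, -, hr⟩ := exists_forall_commute_mem_zpowers hA1
  obtain ⟨i, hi⟩ := hr _ hAX.symm
  obtain ⟨j, hj⟩ := hr _ hAY.symm
  have hXY : X * Y = Y * X := by
    rw [← hi, ← hj]
    exact ((Commute.refl r).zpow_left i).zpow_right j
  have hred1 := isReduced_conj_append_conj hU.isReduced hU.isReduced hUa hUa hUb hUb hst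
      hsa hsb hta htb
  have hred2 := isReduced_conj_append_conj hU.isReduced hU.isReduced hUa hUa hUb hUb hst.symm
      hta htb hsa hsb
  have := hred1.mk_injOn hred2 (by rw [← mul_mk, ← mul_mk, mk_conj, mk_conj]; exact hXY)
  simp only [List.cons_append, List.cons.injEq] at this
  exact hst this.1

/-- Every coset of a nontrivial normal subgroup of a nonabelian free group contains an element
which generates its own centralizer. -/
theorem exists_mem_forall_commute [Nontrivial α] {N : Subgroup (FreeGroup α)} [hN : N.Normal]
    (hN1 : N ≠ ⊥) (f : FreeGroup α) :
    ∃ n ∈ N, ∀ c, Commute c (f * n) → c ∈ Subgroup.zpowers (f * n) := by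
  classical
  wlog hf : f ≠ 1 generalizing f
  · rw [not_not] at hf
    subst hf
    obtain ⟨⟨w, hwN⟩, hw⟩ := N.ne_bot_iff_exists_ne_one.mp hN1
    obtain ⟨n, hn, h⟩ := this w fun h => hw (Subtype.ext h)
    exact ⟨w * n, N.mul_mem hwN hn, by simpa only [one_mul] using h⟩
  obtain ⟨g, A, hA, rfl⟩ := exists_conj_isCyclicallyReduced f
  have hA0 : A ≠ [] := by
    rintro rfl
    exact hf (by simp [← one_eq_mk])
  obtain ⟨n, hn, h⟩ := exists_mem_forall_commute_of_isCyclicallyReduced hN1 hA hA0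
  refine ⟨g * n * g⁻¹, hN.conj_mem _ hn _, fun c hc => ?_⟩
  have e : g * mk A * g⁻¹ * (g * n * g⁻¹) = MulAut.conj g (mk A * n) := by
    rw [MulAut.conj_apply]; group
  rw [e] at hc ⊢
  have hc' : Commute (g⁻¹ * c * g) (mk A * n) := by
    have := hc.map (MulAut.conj g⁻¹)
    simpa [mul_assoc] using this
  obtain ⟨k, hk⟩ := h _ hc'
  refine ⟨k, ?_⟩
  simp only at hk ⊢
  rw [← _root_.map_zpow, hk, MulAut.conj_apply]
  group

end FreeGroup

section FreeTransport

variable {F α : Type*} [Group F]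

theorem MulEquiv.exists_isCoP_conj_of_freeGroup (e : F ≃* FreeGroup α) {p : ℕ} (hp : p.Prime) (u v : F)
    {K : Subgroup F} (hK : K.IsCoP p) :
    ∃ L : Subgroup F, L.IsCoP p ∧ ∀ g, g * u * g⁻¹ * v⁻¹ ∈ L →
      ∃ k ∈ K, (g * k) * u * (g * k)⁻¹ = v := by
  obtain ⟨L, hL, h⟩ := FreeGroup.exists_isCoP_conj hp (e u) (e v)
    (hK.map (f := e.toMonoidHom) e.surjective)
  refine ⟨L.comap e.toMonoidHom, hL.comap _, fun g hg => ?_⟩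
  obtain ⟨_, ⟨k, hk, rfl⟩, hkv⟩ := h (e g) (by simpa using hg)
  exact ⟨k, hk, e.injective (by simpa using hkv)⟩

theorem MulEquiv.exists_forall_commute_mem_zpowers_of_freeGroup (e : F ≃* FreeGroup α) {f : F} (hf : f ≠ 1) :
    ∃ r : F, ∀ c, Commute c f → c ∈ Subgroup.zpowers r := by
  obtain ⟨r, -, hr⟩ := FreeGroup.exists_forall_commute_mem_zpowers (f := e f) (by simpa using hf)
  refine ⟨e.symm r, fun c hc => ?_⟩
  obtain ⟨n, hn⟩ := hr (e c) (hc.map e)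
  exact ⟨n, e.injective (by simpa using hn)⟩

theorem MulEquiv.exists_mem_forall_commute_of_freeGroup (e : F ≃* FreeGroup α) (hF : ∃ a b : F, a * b ≠ b * a)
    {N : Subgroup F} (hN : N.Normal) (hN1 : N ≠ ⊥) (f : F) :
    ∃ n ∈ N, ∀ c, Commute c (f * n) → c ∈ Subgroup.zpowers (f * n) := by
  have : Nontrivial α := by
    by_contra hα
    rw [not_nontrivial_iff_subsingleton] at hα
    obtain ⟨a, b, hab⟩ := hF
    have := e.isCyclic.mpr FreeGroup.isCyclic_of_subsingleton_generators
    have := IsCyclic.isMulCommutative (α := F)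
    exact hab (mul_comm' a b)
  have : (N.map e.toMonoidHom).Normal := hN.map _ e.surjective
  obtain ⟨_, ⟨n, hn, rfl⟩, h⟩ := FreeGroup.exists_mem_forall_commute (N := N.map e.toMonoidHom)
    (by rwa [Ne, (Subgroup.map_eq_bot_iff_of_injective N e.injective)]) (e f)
  refine ⟨n, hn, fun c hc => ?_⟩
  obtain ⟨k, hk⟩ := h (e c) (by simpa using hc.map e)
  exact ⟨k, e.injective (by simpa using hk)⟩

end FreeTransport

theorem conjSepC_CP_iff {p : ℕ} {G : Type} [Group G] :
    ConjSepC (CP p) G ↔ ∀ x y : G, ¬ IsConj x y →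
      ∃ L : Subgroup G, L.IsCoP p ∧ ∀ g, g * x * g⁻¹ * y⁻¹ ∉ L := by
  refine forall₃_congr fun x y _ => ⟨?_, ?_⟩
  · rintro ⟨M, ⟨hM, hMp⟩, φ, hφ⟩
    refine ⟨φ.ker, .ker hMp φ, fun g hg => hφ (isConj_iff.mpr ⟨φ g, ?_⟩)⟩
    simpa [MonoidHom.mem_ker, mul_inv_eq_one] using hg
  · rintro ⟨L, hL, h⟩
    have := hL.normal
    have := hL.finiteIndex
    refine ⟨GrpB.of (G ⧸ L), ⟨inferInstanceAs (Finite (G ⧸ L)), hL.isPGroup_quotient⟩,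
      QuotientGroup.mk' L, fun hc => ?_⟩
    obtain ⟨c, hc⟩ := isConj_iff.mp hc
    obtain ⟨g, rfl⟩ := QuotientGroup.mk'_surjective L c
    refine h g ((QuotientGroup.eq_one_iff _).mp ?_)
    change QuotientGroup.mk' L (g * x * g⁻¹ * y⁻¹) = 1
    rw [map_mul, map_mul, map_mul, map_inv, map_inv, mul_inv_eq_one]
    exact hc

theorem residuallyC_CP_iff {p : ℕ} {P : Type} [Group P] :
    ResiduallyC (CP p) P ↔ ∀ q : P, q ≠ 1 → ∃ L : Subgroup P, L.IsCoP p ∧ q ∉ L := by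
  refine forall₂_congr fun q _ => ⟨?_, ?_⟩
  · rintro ⟨M, ⟨hM, hMp⟩, φ, hφ⟩
    exact ⟨φ.ker, .ker hMp φ, hφ⟩
  · rintro ⟨L, hL, h⟩
    have := hL.normal
    have := hL.finiteIndex
    exact ⟨GrpB.of (P ⧸ L), ⟨inferInstanceAs (Finite (P ⧸ L)), hL.isPGroup_quotient⟩,
      QuotientGroup.mk' L, fun hc => h ((QuotientGroup.eq_one_iff _).mp hc)⟩

theorem residuallyC_CP_and_periodic_iff {p : ℕ} (hp : p.Prime) {P : Type} [Group P] :
    ((∀ g : P, IsOfFinOrder g) ∧ ResiduallyC (CP p) P) ↔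
      (IsPGroup p P ∧ ResiduallyC CFin P) := by
  constructor
  · rintro ⟨hper, hres⟩
    refine ⟨fun g => ?_, fun q hq => ?_⟩
    · obtain ⟨k, m, hm, hkm⟩ := Nat.exists_eq_pow_mul_and_not_dvd
        (hper g).orderOf_pos.ne' p hp.ne_one
      refine ⟨k, ?_⟩
      by_contra hne
      obtain ⟨L, hL, hgL⟩ := residuallyC_CP_iff.mp hres _ hne
      have := hL.normal
      obtain ⟨l, hl⟩ := hL.pow_mem (g ^ p ^ k)
      have h1 : (g ^ p ^ k) ^ m = 1 := by rw [← pow_mul, ← hkm, pow_orderOf_eq_one]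
      have hcop : Nat.Coprime (p ^ l) m := ((Nat.Prime.coprime_iff_not_dvd hp).mpr hm).pow_left l
      have hz := Nat.gcd_eq_gcd_ab (p ^ l) m
      rw [hcop, Nat.cast_one] at hz
      refine hgL ?_
      have : g ^ p ^ k = ((g ^ p ^ k) ^ p ^ l) ^ (Nat.gcdA (p ^ l) m) := by
        conv_lhs => rw [← zpow_one (g ^ p ^ k), hz, zpow_add, zpow_mul, zpow_mul, zpow_natCast,
          zpow_natCast, h1, one_zpow, mul_one]
      rw [this]
      exact L.zpow_mem hl _
    · obtain ⟨M, hM, φ, hφ⟩ := hres q hq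
      exact ⟨M, hM.1, φ, hφ⟩
  · rintro ⟨hP, hres⟩
    refine ⟨fun g => ?_, fun q hq => ?_⟩
    · obtain ⟨k, hk⟩ := hP g
      exact isOfFinOrder_iff_pow_eq_one.mpr ⟨_, pow_pos hp.pos k, hk⟩
    · obtain ⟨M, hM, φ, hφ⟩ := hres q hq
      have : Finite M.carrier := hM
      refine ⟨GrpB.of φ.range, ⟨inferInstanceAs (Finite φ.range),
        hP.of_surjective φ.rangeRestrict φ.rangeRestrict_surjective⟩, φ.rangeRestrict, fun h => ?_⟩
      exact hφ (congrArg Subtype.val h)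

section FiberProduct

variable {F₁ F₂ P : Type*} [Group F₁] [Group F₂] [Group P] {ψ₁ : F₁ →* P} {ψ₂ : F₂ →* P}
  {G : Subgroup (F₁ × F₂)} {p : ℕ}

theorem finite_image_conjugators {F : Type*} [Group F] (ψ : F →* P)
    (hP : ∀ q : P, IsOfFinOrder q) {x : F} (y : F)
    (hx : ∃ r : F, ∀ c, Commute c x → c ∈ Subgroup.zpowers r) :
    (ψ '' {s | s * x * s⁻¹ = y}).Finite := by
  obtain h | ⟨s, hs⟩ := Set.eq_empty_or_nonempty {s | s * x * s⁻¹ = y}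
  · rw [h, Set.image_empty]; exact Set.finite_empty
  obtain ⟨r, hr⟩ := hx
  have hfin : (Subgroup.zpowers (ψ r) : Set P).Finite := (hP (ψ r)).finite_zpowers
  refine (hfin.image (fun q => ψ s * q)).subset ?_
  rintro _ ⟨t, ht, rfl⟩
  rw [Set.mem_ofPred_eq] at hs ht
  have hc : Commute (s⁻¹ * t) x := by
    have h : t * x = y * t := by rw [← ht]; group
    have h' : y = s * x * s⁻¹ := hs.symm
    change s⁻¹ * t * x = x * (s⁻¹ * t)
    rw [mul_assoc, h, h']
    group
  obtain ⟨n, hn⟩ := hr _ hc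
  refine ⟨ψ r ^ n, ⟨n, rfl⟩, ?_⟩
  simp only at hn ⊢
  rw [← map_zpow, hn, ← map_mul, mul_inv_cancel_left]

theorem exists_isCoP_of_not_isConj (hψ₁ : Function.Surjective ψ₁) (hψ₂ : Function.Surjective ψ₂)
    (hG : ∀ x, x ∈ G ↔ ψ₁ x.1 = ψ₂ x.2) (hP : ∀ q : P, IsOfFinOrder q)
    (hres : ∀ q : P, q ≠ 1 → ∃ L : Subgroup P, L.IsCoP p ∧ q ∉ L)
    (hU₁ : ∀ (u v : F₁) {K : Subgroup F₁}, K.IsCoP p → ∃ L : Subgroup F₁, L.IsCoP p ∧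
      ∀ g, g * u * g⁻¹ * v⁻¹ ∈ L → ∃ k ∈ K, (g * k) * u * (g * k)⁻¹ = v)
    (hU₂ : ∀ (u v : F₂) {K : Subgroup F₂}, K.IsCoP p → ∃ L : Subgroup F₂, L.IsCoP p ∧
      ∀ g, g * u * g⁻¹ * v⁻¹ ∈ L → ∃ k ∈ K, (g * k) * u * (g * k)⁻¹ = v)
    (hC₁ : ∀ f : F₁, f ≠ 1 → ∃ r : F₁, ∀ c, Commute c f → c ∈ Subgroup.zpowers r)
    (hC₂ : ∀ f : F₂, f ≠ 1 → ∃ r : F₂, ∀ c, Commute c f → c ∈ Subgroup.zpowers r)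
    {x y : G} (hxy : ¬ IsConj x y) :
    ∃ L : Subgroup G, L.IsCoP p ∧ ∀ g, g * x * g⁻¹ * y⁻¹ ∉ L := by
  obtain ⟨⟨x₁, x₂⟩, hx⟩ := x
  obtain ⟨⟨y₁, y₂⟩, hy⟩ := y
  have hconj {s₁ : F₁} {s₂ : F₂} (h₁ : s₁ * x₁ * s₁⁻¹ = y₁) (h₂ : s₂ * x₂ * s₂⁻¹ = y₂) :
      ψ₁ s₁ ≠ ψ₂ s₂ := fun h =>
    hxy (isConj_iff.mpr ⟨⟨(s₁, s₂), (hG _).mpr h⟩, Subtype.ext (Prod.ext h₁ h₂)⟩)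
  set D : Set P := Set.image2 (fun a b => a⁻¹ * b) (ψ₁ '' {s | s * x₁ * s⁻¹ = y₁})
    (ψ₂ '' {s | s * x₂ * s⁻¹ = y₂}) with hD
  have hDfin : D.Finite := by
    by_cases h₁ : x₁ = 1
    · convert Set.finite_empty
      refine Set.eq_empty_of_forall_notMem ?_
      rintro _ ⟨_, ⟨s₁, hs₁, rfl⟩, _, ⟨s₂, hs₂, rfl⟩, rfl⟩
      rw [Set.mem_ofPred_eq] at hs₁ hs₂
      obtain ⟨g, hg⟩ := hψ₁ (ψ₂ s₂)
      exact hconj (s₁ := g) (by rw [← hs₁, h₁]; group) hs₂ hg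
    by_cases h₂ : x₂ = 1
    · convert Set.finite_empty
      refine Set.eq_empty_of_forall_notMem ?_
      rintro _ ⟨_, ⟨s₁, hs₁, rfl⟩, _, ⟨s₂, hs₂, rfl⟩, rfl⟩
      rw [Set.mem_ofPred_eq] at hs₁ hs₂
      obtain ⟨g, hg⟩ := hψ₂ (ψ₁ s₁)
      exact hconj (s₂ := g) hs₁ (by rw [← hs₂, h₂]; group) hg.symm
    exact (finite_image_conjugators ψ₁ hP y₁ (hC₁ x₁ h₁)).image2 _
      (finite_image_conjugators ψ₂ hP y₂ (hC₂ x₂ h₂))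
  obtain ⟨K, hK, hKD⟩ := Subgroup.IsCoP.exists_disjoint (p := p) hDfin (by
    rintro _ ⟨_, ⟨s₁, hs₁, rfl⟩, _, ⟨s₂, hs₂, rfl⟩, rfl⟩
    refine hres _ fun h => hconj hs₁ hs₂ (inv_mul_eq_one.mp h))
  obtain ⟨L₁, hL₁, h₁⟩ := hU₁ x₁ y₁ (hK.comap ψ₁)
  obtain ⟨L₂, hL₂, h₂⟩ := hU₂ x₂ y₂ (hK.comap ψ₂)
  refine ⟨_, (hL₁.comap ((MonoidHom.fst F₁ F₂).comp G.subtype)).inf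
    (hL₂.comap ((MonoidHom.snd F₁ F₂).comp G.subtype)), ?_⟩
  rintro ⟨⟨g₁, g₂⟩, hg⟩ ⟨hgL₁, hgL₂⟩
  have hg' : ψ₁ g₁ = ψ₂ g₂ := (hG _).mp hg
  obtain ⟨k₁, hk₁, e₁⟩ := h₁ g₁ hgL₁
  obtain ⟨k₂, hk₂, e₂⟩ := h₂ g₂ hgL₂
  refine hKD _ ⟨_, ⟨_, e₁, rfl⟩, _, ⟨_, e₂, rfl⟩, rfl⟩ ?_
  have : (ψ₁ (g₁ * k₁))⁻¹ * ψ₂ (g₂ * k₂) = (ψ₁ k₁)⁻¹ * ψ₂ k₂ := by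
    rw [map_mul, map_mul, hg']; group
  change (ψ₁ (g₁ * k₁))⁻¹ * ψ₂ (g₂ * k₂) ∈ K
  rw [this]
  exact K.mul_mem (K.inv_mem hk₁) hk₂

theorem exists_isCoP_notMem_of_fiberProduct (hψ₁ : Function.Surjective ψ₁)
    (hG : ∀ x, x ∈ G ↔ ψ₁ x.1 = ψ₂ x.2)
    (hE₁ : ∃ n ∈ ψ₁.ker, ∀ c, Commute c n → c ∈ Subgroup.zpowers n)
    (hE₂ : ∃ n ∈ ψ₂.ker, ∀ c, Commute c n → c ∈ Subgroup.zpowers n)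
    (hψ₂ : Function.Surjective ψ₂)
    (hsep : ∀ x y : G, ¬ IsConj x y →
      ∃ L : Subgroup G, L.IsCoP p ∧ ∀ g, g * x * g⁻¹ * y⁻¹ ∉ L) {q : P} (hq : q ≠ 1) :
    ∃ L : Subgroup P, L.IsCoP p ∧ q ∉ L := by
  obtain ⟨n₁, hn₁, hc₁⟩ := hE₁
  obtain ⟨n₂, hn₂, hc₂⟩ := hE₂
  obtain ⟨g, rfl⟩ := hψ₁ q
  rw [MonoidHom.mem_ker] at hn₁ hn₂
  obtain ⟨L, hL, h⟩ := hsep ⟨(n₁, n₂), (hG _).mpr (hn₁.trans hn₂.symm)⟩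
    ⟨(g * n₁ * g⁻¹, n₂), (hG _).mpr (by simp [hn₁, hn₂])⟩ (by
      intro hconj
      obtain ⟨⟨⟨c₁, c₂⟩, hcG⟩, hc⟩ := isConj_iff.mp hconj
      have h₁ : c₁ * n₁ * c₁⁻¹ = g * n₁ * g⁻¹ := congrArg (fun z => z.1.1) hc
      have h₂ : c₂ * n₂ * c₂⁻¹ = n₂ := congrArg (fun z => z.1.2) hc
      obtain ⟨i, hi⟩ := hc₁ (g⁻¹ * c₁) (by
        have : c₁ * n₁ = g * n₁ * g⁻¹ * c₁ := by rw [← h₁]; group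
        change g⁻¹ * c₁ * n₁ = n₁ * (g⁻¹ * c₁)
        rw [mul_assoc, this]; group)
      obtain ⟨j, hj⟩ := hc₂ c₂ (mul_inv_eq_iff_eq_mul.mp h₂)
      have e₁ : ψ₁ c₁ = ψ₁ g := by
        have : c₁ = g * n₁ ^ i := by simp only at hi; rw [hi, mul_inv_cancel_left]
        rw [this, map_mul, map_zpow, hn₁, one_zpow, mul_one]
      have e₂ : ψ₂ c₂ = 1 := by
        simp only at hj
        rw [← hj, map_zpow, hn₂, one_zpow]
      exact hq (e₁.symm.trans (((hG _).mp hcG).trans e₂)))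
  have hsurj : Function.Surjective (ψ₁.comp ((MonoidHom.fst F₁ F₂).comp G.subtype)) := by
    intro q
    obtain ⟨a, rfl⟩ := hψ₁ q
    obtain ⟨b, hb⟩ := hψ₂ (ψ₁ a)
    exact ⟨⟨(a, b), (hG _).mpr hb.symm⟩, rfl⟩
  refine ⟨_, hL.map hsurj, ?_⟩
  rintro ⟨⟨⟨l₁, l₂⟩, hlG⟩, hlL, hl⟩
  have hl : ψ₁ l₁ = ψ₁ g := hl
  have hm : ψ₁ (l₁⁻¹ * g) = 1 := by rw [map_mul, map_inv, hl, inv_mul_cancel]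
  set l : G := ⟨(l₁, l₂), hlG⟩ with hl'
  set w : G := ⟨(l₁⁻¹ * g * n₁ * (l₁⁻¹ * g)⁻¹, 1), (hG _).mpr (by
    change ψ₁ (l₁⁻¹ * g * n₁ * (l₁⁻¹ * g)⁻¹) = ψ₂ 1
    rw [map_mul, map_mul, map_inv, hm, hn₁]; simp)⟩ with hw
  refine h ⟨(l₁⁻¹ * g, 1), (hG _).mpr (by simpa using hm)⟩ ?_
  convert L.mul_mem (hL.normal.conj_mem _ hlL w) (L.inv_mem hlL) using 1
  refine Subtype.ext (Prod.ext ?_ ?_)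
  · simp [hw, hl', mul_assoc]
  · simp [hw, hl']

theorem isOfFinOrder_of_fiberProduct (hp : p.Prime) (hψ₁ : Function.Surjective ψ₁)
    (hψ₂ : Function.Surjective ψ₂) (hG : ∀ x, x ∈ G ↔ ψ₁ x.1 = ψ₂ x.2)
    (hE₁ : ∀ f, ∃ n ∈ ψ₁.ker, ∀ c, Commute c (f * n) → c ∈ Subgroup.zpowers (f * n))
    (hE₂ : ∀ f, ∃ n ∈ ψ₂.ker, ∀ c, Commute c (f * n) → c ∈ Subgroup.zpowers (f * n))
    (hsep : ∀ x y : G, ¬ IsConj x y →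
      ∃ L : Subgroup G, L.IsCoP p ∧ ∀ g, g * x * g⁻¹ * y⁻¹ ∉ L) (q : P) :
    IsOfFinOrder q := by
  by_contra hq
  obtain ⟨a, rfl⟩ := hψ₁ q
  obtain ⟨b, hb⟩ := hψ₂ (ψ₁ a)
  obtain ⟨n₁, hn₁, hc₁⟩ := hE₁ (a ^ (p + 1))
  obtain ⟨n₂, hn₂, hc₂⟩ := hE₂ (b ^ (p + 1))
  rw [MonoidHom.mem_ker] at hn₁ hn₂
  set x₁ := a ^ (p + 1) * n₁ with hx₁
  set x₂ := b ^ (p + 1) * n₂ with hx₂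
  have hψx₁ : ψ₁ x₁ = ψ₁ a ^ (p + 1) := by rw [hx₁, map_mul, map_pow, hn₁, mul_one]
  have hψx₂ : ψ₂ x₂ = ψ₁ a ^ (p + 1) := by rw [hx₂, map_mul, map_pow, hn₂, mul_one, hb]
  obtain ⟨L, hL, h⟩ := hsep ⟨(x₁, x₂), (hG _).mpr (hψx₁.trans hψx₂.symm)⟩
    ⟨(x₁, b * x₂ * b⁻¹), (hG _).mpr (by
      change ψ₁ x₁ = ψ₂ (b * x₂ * b⁻¹)
      rw [hψx₁, map_mul, map_mul, map_inv, hψx₂, hb]; group)⟩ (by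
      intro hconj
      obtain ⟨⟨⟨c₁, c₂⟩, hcG⟩, hc⟩ := isConj_iff.mp hconj
      have h₁ : c₁ * x₁ * c₁⁻¹ = x₁ := congrArg (fun z => z.1.1) hc
      have h₂ : c₂ * x₂ * c₂⁻¹ = b * x₂ * b⁻¹ := congrArg (fun z => z.1.2) hc
      obtain ⟨j, hj⟩ := hc₂ (b⁻¹ * c₂) (by
        have : c₂ * x₂ = b * x₂ * b⁻¹ * c₂ := by rw [← h₂]; group
        change b⁻¹ * c₂ * x₂ = x₂ * (b⁻¹ * c₂)
        rw [mul_assoc, this]; group)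
      obtain ⟨i, hi⟩ := hc₁ c₁ (mul_inv_eq_iff_eq_mul.mp h₁)
      simp only at hi hj
      have e₁ : ψ₁ c₁ = ψ₁ a ^ (((p + 1 : ℕ) : ℤ) * i) := by
        rw [← hi, map_zpow, hψx₁, zpow_mul, zpow_natCast]
      have e₂ : ψ₂ c₂ = ψ₁ a ^ (1 + ((p + 1 : ℕ) : ℤ) * j) := by
        have : c₂ = b * x₂ ^ j := by rw [hj, mul_inv_cancel_left]
        rw [this, map_mul, map_zpow, hψx₂, hb, zpow_add, zpow_one, zpow_mul, zpow_natCast]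
      have e := e₁.symm.trans (((hG _).mp hcG).trans e₂)
      have e' := injective_zpow_iff_not_isOfFinOrder.mpr hq e
      have hdvd : ((p + 1 : ℕ) : ℤ) ∣ 1 := ⟨i - j, by linear_combination -e'⟩
      have := Nat.le_of_dvd one_pos (Int.natCast_dvd_natCast.mp (by exact_mod_cast hdvd))
      have := hp.two_le
      omega)
  set A : G := ⟨(a, b), (hG _).mpr hb.symm⟩
  obtain ⟨e, he⟩ := hL.pow_mem A
  have hcop : IsCoprime ((p ^ e : ℕ) : ℤ) ((p + 1 : ℕ) : ℤ) :=
    Nat.isCoprime_iff_coprime.mpr (Nat.Coprime.pow_left _ (by simp))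
  obtain ⟨t, s, hts⟩ := hcop
  have hAk : A ^ (((p ^ e : ℕ) : ℤ) * t) ∈ L := by
    rw [zpow_mul, zpow_natCast]
    exact L.zpow_mem he t
  set k : ℤ := ((p ^ e : ℕ) : ℤ) * t with hk
  have hks : k = 1 + ((p + 1 : ℕ) : ℤ) * (-s) := by rw [hk]; linear_combination hts
  set w : G := ⟨(n₁, 1), (hG _).mpr (by simpa using hn₁)⟩ with hw
  refine h ⟨(a ^ k, b * x₂ ^ (-s)), (hG _).mpr ?_⟩ ?_
  · change ψ₁ (a ^ k) = ψ₂ (b * x₂ ^ (-s))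
    rw [map_zpow, map_mul, map_zpow, hψx₂, hb, hks, zpow_add, zpow_one, zpow_mul, zpow_natCast]
  · have hA₁ : (A : F₁ × F₂).1 = a := rfl
    have hA₂ : (A : F₁ × F₂).2 = b := rfl
    have hAk₁ : ((A ^ k : G) : F₁ × F₂).1 = a ^ k :=
      map_zpow ((MonoidHom.fst F₁ F₂).comp G.subtype) A k
    have hAk₂ : ((A ^ k : G) : F₁ × F₂).2 = b ^ k :=
      map_zpow ((MonoidHom.snd F₁ F₂).comp G.subtype) A k
    convert hL.normal.conj_mem _ (L.mul_mem hAk (hL.normal.conj_mem _ (L.inv_mem hAk) w))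
      (A ^ (p + 1)) using 1
    refine Subtype.ext (Prod.ext ?_ ?_)
    · simp only [hw, hx₁, Subgroup.coe_mul, Subgroup.coe_inv, Subgroup.coe_pow,
        Prod.fst_mul, Prod.fst_inv, Prod.pow_fst, hAk₁, hA₁]
      group
    · simp only [hw, Subgroup.coe_mul, Subgroup.coe_inv, Subgroup.coe_pow,
        Prod.snd_mul, Prod.snd_inv, Prod.pow_snd, hAk₂, hA₂]
      group

end FiberProduct

theorem IsSubdirect.exists_surjective_hom {F₁ F₂ : Type} [Group F₁] [Group F₂]
    {G : Subgroup (F₁ × F₂)} (hG : IsSubdirect G) {N : Subgroup F₁}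
    (hN : N = G.comap (MonoidHom.inl F₁ F₂)) [N.Normal] :
    ∃ ψ : F₂ →* F₁ ⧸ N, Function.Surjective ψ ∧
      ∀ x, x ∈ G ↔ QuotientGroup.mk' N x.1 = ψ x.2 := by
  have hfst (a : F₁) : ∃ b, (a, b) ∈ G := by
    obtain ⟨⟨_, b⟩, h, rfl⟩ := hG.1 ▸ Subgroup.mem_top a
    exact ⟨b, h⟩
  have hsnd (b : F₂) : ∃ a, (a, b) ∈ G := by
    obtain ⟨⟨a, _⟩, h, rfl⟩ := hG.2 ▸ Subgroup.mem_top b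
    exact ⟨a, h⟩
  choose s hs using hsnd
  have key (a : F₁) (b : F₂) : (a, b) ∈ G ↔ QuotientGroup.mk' N a = QuotientGroup.mk' N (s b) := by
    have h : (s b, b)⁻¹ * (a, b) = MonoidHom.inl F₁ F₂ ((s b)⁻¹ * a) := by simp
    rw [eq_comm, QuotientGroup.mk'_apply, QuotientGroup.mk'_apply, QuotientGroup.eq, hN,
      Subgroup.mem_comap, ← h, Subgroup.mul_mem_cancel_left _ (G.inv_mem (hs b))]
  refine ⟨MonoidHom.mk' (fun b => QuotientGroup.mk' N (s b)) fun b c => ?_, fun q => ?_,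
    fun x => key x.1 x.2⟩
  · rw [← map_mul, eq_comm, ← key]
    exact G.mul_mem (hs b) (hs c)
  · obtain ⟨a, rfl⟩ := QuotientGroup.mk'_surjective N q
    obtain ⟨b, hb⟩ := hfst a
    exact ⟨b, ((key a b).mp hb).symm⟩

/-- Corollary 7.8: a full subdirect product of two non-abelian
free groups is `p`-conjugacy separable iff `F₁/N₁` is a periodic residually-(finite
`p`-group) group iff `F₁/N₁` is a residually finite `p`-group. -/
theorem stmt4 (p : ℕ) (hp : p.Prime)
    (F₁ F₂ : Type) [Group F₁] [Group F₂]
    (hF₁ : IsNonAbelianFree F₁) (hF₂ : IsNonAbelianFree F₂)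
    (G : Subgroup (F₁ × F₂)) (hG : IsFullSubdirect G)
    (N₁ : Subgroup F₁) (hN₁ : N₁ = Subgroup.comap (MonoidHom.inl F₁ F₂) G) [N₁.Normal] :
    (ConjSepC (CP p) ↥G ↔
      ((∀ g : F₁ ⧸ N₁, IsOfFinOrder g) ∧ ResiduallyC (CP p) (F₁ ⧸ N₁))) ∧
    (((∀ g : F₁ ⧸ N₁, IsOfFinOrder g) ∧ ResiduallyC (CP p) (F₁ ⧸ N₁)) ↔
      (IsPGroup p (F₁ ⧸ N₁) ∧ ResiduallyC CFin (F₁ ⧸ N₁))) := by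
  refine ⟨?_, residuallyC_CP_and_periodic_iff hp⟩
  obtain ⟨⟨S₁, ⟨e₁⟩⟩, hab₁⟩ := hF₁
  obtain ⟨⟨S₂, ⟨e₂⟩⟩, hab₂⟩ := hF₂
  obtain ⟨hsub, hfull₁, hfull₂⟩ := hG
  obtain ⟨ψ₂, hψ₂, hmem⟩ := hsub.exists_surjective_hom hN₁
  have hψ₁ := QuotientGroup.mk'_surjective N₁
  have hker₁ : (QuotientGroup.mk' N₁).ker ≠ ⊥ := by rwa [QuotientGroup.ker_mk', hN₁]
  have hker₂ : ψ₂.ker ≠ ⊥ := by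
    convert hfull₂ using 1
    ext b
    rw [MonoidHom.mem_ker, Subgroup.mem_comap, hmem, eq_comm]
    simp
  have hE₁ := e₁.exists_mem_forall_commute_of_freeGroup hab₁ inferInstance hker₁
  have hE₂ := e₂.exists_mem_forall_commute_of_freeGroup hab₂ inferInstance hker₂
  rw [conjSepC_CP_iff, residuallyC_CP_iff]
  refine ⟨fun hsep => ⟨isOfFinOrder_of_fiberProduct hp hψ₁ hψ₂ hmem hE₁ hE₂ hsep, fun q hq =>
    exists_isCoP_notMem_of_fiberProduct hψ₁ hmem (by simpa only [one_mul] using hE₁ 1)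
      (by simpa only [one_mul] using hE₂ 1) hψ₂ hsep hq⟩, ?_⟩
  rintro ⟨hper, hres⟩ x y hxy
  exact exists_isCoP_of_not_isConj hψ₁ hψ₂ hmem hper hres
    (e₁.exists_isCoP_conj_of_freeGroup hp) (e₂.exists_isCoP_conj_of_freeGroup hp)
    (fun _ => e₁.exists_forall_commute_mem_zpowers_of_freeGroup)
    (fun _ => e₂.exists_forall_commute_mem_zpowers_of_freeGroup) hxy
end

section
/- Let F₁ and F₂ be free groups (of arbitrary ranks, possibly zero) and let G be a subgroup of F₁ × F₂. Then G is p-conjugacy separable for at least two distinct primes p if and only if G is itself isomorphic to a direct product of two free groups (one or both of which may be trivial). -/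
/-- Pairs of a finitely supported chain and a group element, with the semidirect product
multiplication coming from left translation of chains. -/
@[ext]
structure MagnusGroup (k Q : Type) [CommRing k] where
  chain : Q →₀ k
  val : Q

namespace MagnusGroup

variable {k Q : Type} [CommRing k] [Group Q]

noncomputable instance : Mul (MagnusGroup k Q) :=
  ⟨fun a b => ⟨a.chain + b.chain.mapDomain (a.val * ·), a.val * b.val⟩⟩
noncomputable instance : One (MagnusGroup k Q) := ⟨⟨0, 1⟩⟩
noncomputable instance : Inv (MagnusGroup k Q) := ⟨fun a => ⟨-a.chain.mapDomain (a.val⁻¹ * ·), a.val⁻¹⟩⟩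

theorem mul_chain (a b : MagnusGroup k Q) :
    (a * b).chain = a.chain + b.chain.mapDomain (a.val * ·) := rfl
@[simp] theorem mul_val (a b : MagnusGroup k Q) : (a * b).val = a.val * b.val := rfl
@[simp] theorem one_chain : (1 : MagnusGroup k Q).chain = 0 := rfl
@[simp] theorem one_val : (1 : MagnusGroup k Q).val = 1 := rfl
theorem inv_chain (a : MagnusGroup k Q) :
    (a⁻¹).chain = -a.chain.mapDomain (a.val⁻¹ * ·) := rfl
@[simp] theorem inv_val (a : MagnusGroup k Q) : (a⁻¹).val = a.val⁻¹ := rfl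

theorem mapDomain_mul_mul (c : Q →₀ k) (a b : Q) :
    (c.mapDomain (b * ·)).mapDomain (a * ·) = c.mapDomain (a * b * ·) := by
  rw [← Finsupp.mapDomain_comp]
  congr 1
  ext x
  simp [mul_assoc]

theorem mapDomain_one_mul (c : Q →₀ k) : c.mapDomain ((1 : Q) * ·) = c := by
  simp only [one_mul]
  exact Finsupp.mapDomain_id

noncomputable instance : Group (MagnusGroup k Q) where
  mul_assoc a b c := by
    ext1
    · simp only [mul_chain, mul_val, Finsupp.mapDomain_add, mapDomain_mul_mul, add_assoc]
    · exact mul_assoc _ _ _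
  one_mul a := by
    ext1
    · simp only [mul_chain, one_chain, one_val, mapDomain_one_mul, zero_add]
    · exact one_mul _
  mul_one a := by
    ext1
    · simp only [mul_chain, one_chain, Finsupp.mapDomain_zero, add_zero]
    · exact mul_one _
  inv_mul_cancel a := by
    ext1
    · simp only [mul_chain, inv_chain, inv_val, one_chain, neg_add_cancel]
    · exact inv_mul_cancel _

/-- The projection to the acting group. -/
def valHom : MagnusGroup k Q →* Q where
  toFun := val
  map_one' := rfl
  map_mul' _ _ := rfl

theorem pow_chain_of_val_eq_one {a : MagnusGroup k Q} (h : a.val = 1) (n : ℕ) :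
    a ^ n = ⟨n • a.chain, 1⟩ := by
  induction n with
  | zero => rw [pow_zero, zero_smul]; rfl
  | succ n ih =>
    rw [pow_succ, ih]
    ext1
    · simp only [mul_chain, mapDomain_one_mul, succ_nsmul]
    · simp [h]

instance [Finite k] [Finite Q] : Finite (MagnusGroup k Q) :=
  Finite.of_injective (fun a => ((a.chain : Q → k), a.val)) fun a b h => by
    simp only [Prod.mk.injEq] at h
    exact MagnusGroup.ext (DFunLike.coe_injective h.1) h.2

theorem isPGroup {p j : ℕ} (hQ : IsPGroup p Q) :
    IsPGroup p (MagnusGroup (ZMod (p ^ j)) Q) := by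
  intro a
  obtain ⟨i, hi⟩ := hQ a.val
  refine ⟨i + j, ?_⟩
  have h1 : (a ^ p ^ i).val = 1 := by
    rw [← hi]; exact map_pow valHom a _
  rw [pow_add, pow_mul, pow_chain_of_val_eq_one h1]
  ext1
  · ext q
    simp
  · rfl

/-- The Magnus homomorphism of `φ` recording the edges labelled `s`. -/
noncomputable def lift {S : Type} (φ : FreeGroup S →* Q) (s : S) :
    FreeGroup S →* MagnusGroup k Q := by
  classical
  exact FreeGroup.lift fun t => ⟨if t = s then Finsupp.single 1 1 else 0, φ (FreeGroup.of t)⟩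

@[simp] theorem lift_val {S : Type} (φ : FreeGroup S →* Q) (s : S) (x : FreeGroup S) :
    (lift (k := k) φ s x).val = φ x := by
  have : valHom.comp (lift (k := k) φ s) = φ := by
    ext t
    simp [lift, valHom]
  exact DFunLike.congr_fun this x

theorem lift_of_chain {S : Type} [DecidableEq S] (φ : FreeGroup S →* Q) (s t : S) :
    (lift (k := k) φ s (FreeGroup.of t)).chain = if t = s then Finsupp.single 1 1 else 0 := by
  simp only [lift, FreeGroup.lift_apply_of]
  congr

end MagnusGroup

open MagnusGroup

/-- The Fox derivative of a word, a finitely supported integral chain on the free group. -/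
noncomputable def foxDerivative {S : Type} (s : S) (x : FreeGroup S) : FreeGroup S →₀ ℤ :=
  (MagnusGroup.lift (k := ℤ) (MonoidHom.id (FreeGroup S)) s x).chain

/-- The pairing of the Fox derivative with a function. -/
noncomputable def foxPairing {S M : Type} [AddCommGroup M] (s : S) (x : FreeGroup S)
    (ψ : FreeGroup S → M) : M :=
  Finsupp.linearCombination ℤ ψ (foxDerivative s x)

section Fox

variable {S M : Type} [AddCommGroup M] (s : S)

theorem foxPairing_mul (x y : FreeGroup S) (ψ : FreeGroup S → M) :
    foxPairing s (x * y) ψ = foxPairing s x ψ + foxPairing s y (fun v => ψ (x * v)) := by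
  unfold foxPairing foxDerivative
  rw [map_mul, mul_chain, map_add, Finsupp.linearCombination_mapDomain, lift_val]
  rfl

theorem foxPairing_one (ψ : FreeGroup S → M) : foxPairing s 1 ψ = 0 := by
  unfold foxPairing foxDerivative
  rw [map_one, one_chain, map_zero]

theorem foxPairing_of_self (ψ : FreeGroup S → M) :
    foxPairing s (FreeGroup.of s) ψ = ψ 1 := by
  classical
  unfold foxPairing foxDerivative
  simp [lift_of_chain]

theorem foxPairing_of_ne {t : S} (h : t ≠ s) (ψ : FreeGroup S → M) :
    foxPairing s (FreeGroup.of t) ψ = 0 := by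
  classical
  unfold foxPairing foxDerivative
  simp [lift_of_chain, h]

theorem foxPairing_inv (x : FreeGroup S) (ψ : FreeGroup S → M) :
    foxPairing s x⁻¹ ψ = -foxPairing s x (fun v => ψ (x⁻¹ * v)) := by
  have := foxPairing_mul s x⁻¹ x ψ
  rw [inv_mul_cancel, foxPairing_one] at this
  exact eq_neg_of_add_eq_zero_left this.symm

/-- The chain of the Magnus homomorphism over a quotient is the push-forward of the Fox
derivative. -/
theorem linearCombination_lift_chain {k Q : Type} [CommRing k] [Group Q]
    (φ : FreeGroup S →* Q) (x : FreeGroup S) (ψ : Q → k) :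
    Finsupp.linearCombination k ψ (MagnusGroup.lift (k := k) φ s x).chain =
      foxPairing s x (fun v => ψ (φ v)) := by
  classical
  have key_mul : ∀ x y : FreeGroup S, ∀ ψ : Q → k,
      Finsupp.linearCombination k ψ (MagnusGroup.lift (k := k) φ s (x * y)).chain =
      Finsupp.linearCombination k ψ (MagnusGroup.lift (k := k) φ s x).chain +
      Finsupp.linearCombination k (fun q => ψ (φ x * q))
        (MagnusGroup.lift (k := k) φ s y).chain := by
    intro x y ψ
    rw [map_mul, mul_chain, map_add, Finsupp.linearCombination_mapDomain, lift_val]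
    rfl
  induction x using FreeGroup.induction_on generalizing ψ with
  | C1 => rw [map_one, one_chain, map_zero, foxPairing_one]
  | of t =>
    by_cases h : t = s
    · subst h
      rw [foxPairing_of_self]; simp [lift_of_chain]
    · rw [foxPairing_of_ne s h]; simp [lift_of_chain, h]
  | inv_of t ih =>
    rw [foxPairing_inv]
    have := key_mul (FreeGroup.of t)⁻¹ (FreeGroup.of t) ψ
    rw [inv_mul_cancel, map_one, one_chain, map_zero] at this
    rw [eq_neg_of_add_eq_zero_left this.symm, ih]
    simp only [map_mul]
  | mul x y hx hy =>
    rw [key_mul, foxPairing_mul, hx, hy]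
    simp only [map_mul]

/-- Discrete integration along a word: the total variation of `h` along the path from `1` to `x`
is computed by the Fox derivatives of `x`. -/
theorem exists_finset_sum_foxPairing (x : FreeGroup S) :
    ∃ T : Finset S, ∀ T', T ⊆ T' → ∀ h : FreeGroup S → M,
      ∑ s ∈ T', foxPairing s x (fun v => h (v * FreeGroup.of s) - h v) = h x - h 1 := by
  classical
  induction x using FreeGroup.induction_on with
  | C1 => exact ⟨∅, fun T' _ h => by simp [foxPairing_one]⟩
  | of t =>
    refine ⟨{t}, fun T' hT h => ?_⟩
    rw [Finset.sum_eq_single t]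
    · rw [foxPairing_of_self, one_mul]
    · intro s _ hs
      rw [foxPairing_of_ne s hs.symm]
    · intro ht
      exact absurd (hT (Finset.mem_singleton_self t)) ht
  | inv_of t ih =>
    obtain ⟨T, hT⟩ := ih
    refine ⟨T, fun T' hT' h => ?_⟩
    have := hT T' hT' (fun v => h ((FreeGroup.of t)⁻¹ * v))
    simp only [mul_one, inv_mul_cancel] at this
    simp only [foxPairing_inv, Finset.sum_neg_distrib, mul_assoc] at this ⊢
    rw [this]
    abel
  | mul x y hx hy =>
    obtain ⟨T₁, h₁⟩ := hx
    obtain ⟨T₂, h₂⟩ := hy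
    refine ⟨T₁ ∪ T₂, fun T' hT' h => ?_⟩
    have e₁ := h₁ T' (Finset.union_subset_left hT') h
    have e₂ := h₂ T' (Finset.union_subset_right hT') (fun v => h (x * v))
    simp only [foxPairing_mul, Finset.sum_add_distrib, mul_assoc, mul_one] at e₁ e₂ ⊢
    rw [e₁, e₂]
    abel

end Fox

/-- If a homomorphism from a subgroup `C` to the integers does not vanish at `z`, then some Fox
derivative of `z` has a nonzero sum over some right coset of `C`. -/
theorem exists_foxPairing_coset_ne_zero {S : Type} (C : Subgroup (FreeGroup S))
    [DecidablePred (· ∈ C)] (η : C →* Multiplicative ℤ) (z : C) (hz : η z ≠ 1) :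
    ∃ s u, foxPairing s (z : FreeGroup S) (fun v => if v * u⁻¹ ∈ C then (1 : ℤ) else 0) ≠ 0 := by
  classical
  by_contra! hzero
  have hinv : ∀ s (ψ : FreeGroup S → ℤ), (∀ c ∈ C, ∀ v, ψ (c * v) = ψ v) →
      foxPairing s (z : FreeGroup S) ψ = 0 := by
    intro s ψ hψ
    let f : FreeGroup S → Quotient (QuotientGroup.rightRel C) := Quotient.mk _
    have hf : ∀ a b, f a = f b ↔ a * b⁻¹ ∈ C := fun a b => by
      rw [eq_comm]
      exact Quotient.eq.trans QuotientGroup.rightRel_apply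
    have hd : (foxDerivative s (z : FreeGroup S)).mapDomain f = 0 := by
      ext y
      obtain ⟨u, rfl⟩ := Quotient.exists_rep y
      have h1 := hzero s u
      have h2 : (fun v => if v * u⁻¹ ∈ C then (1 : ℤ) else 0) =
          (fun q => if q = f u then (1 : ℤ) else 0) ∘ f := by
        ext v
        simp [hf]
      rw [foxPairing, h2, ← Finsupp.linearCombination_mapDomain,
        Finsupp.linearCombination_apply] at h1
      simpa [Finsupp.sum] using h1
    let ψ' : Quotient (QuotientGroup.rightRel C) → ℤ := Quotient.lift ψ fun a b h => by
      have h' : b * a⁻¹ ∈ C := QuotientGroup.rightRel_apply.mp h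
      have := hψ _ h' a
      rw [inv_mul_cancel_right] at this
      exact this.symm
    have h3 : ψ = ψ' ∘ f := rfl
    rw [foxPairing, h3, ← Finsupp.linearCombination_mapDomain, hd, map_zero]
  let r : FreeGroup S → FreeGroup S := fun v => (Quotient.mk (QuotientGroup.rightRel C) v).out
  have hr : ∀ v, v * (r v)⁻¹ ∈ C := fun v =>
    QuotientGroup.rightRel_apply.mp (Quotient.exact (Quotient.out_eq _))
  have hrc : ∀ c ∈ C, ∀ v, r (c * v) = r v := fun c hc v => by
    have : Quotient.mk (QuotientGroup.rightRel C) (c * v) = Quotient.mk _ v :=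
      Quotient.sound (QuotientGroup.rightRel_apply.mpr (by simpa using C.inv_mem hc))
    simp only [r, this]
  let h : FreeGroup S → ℤ := fun v => (η ⟨v * (r v)⁻¹, hr v⟩).toAdd
  have hh : ∀ (c : C) v, h (c * v) = (η c).toAdd + h v := fun c v => by
    simp only [h]
    rw [← toAdd_mul, ← map_mul]
    congr 2
    ext
    simp [hrc c c.2, mul_assoc]
  obtain ⟨T, hT⟩ := exists_finset_sum_foxPairing (M := ℤ) (z : FreeGroup S)
  have h1 := hT T subset_rfl h
  rw [Finset.sum_eq_zero] at h1
  · have h2 := hh z 1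
    rw [mul_one] at h2
    apply hz
    rw [← toAdd_eq_zero]
    linarith
  · intro s _
    apply hinv
    intro c hc v
    have e1 := hh ⟨c, hc⟩ v
    have e2 := hh ⟨c, hc⟩ (v * FreeGroup.of s)
    simp only [← mul_assoc] at e1 e2
    rw [e1, e2]
    ring

section Separation

variable {F : Type} [Group F] (p : ℕ)

/-- The closure, in the pro-`p` topology, of the cyclic subgroup generated by `x`. -/
def pClosure (x : F) : Subgroup F where
  carrier := {h | ∀ (Q : Type) [Group Q] [Finite Q], IsPGroup p Q →
    ∀ φ : F →* Q, φ h ∈ Subgroup.zpowers (φ x)}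
  one_mem' Q _ _ _ φ := by rw [map_one]; exact one_mem _
  mul_mem' ha hb Q _ _ hQ φ := by rw [map_mul]; exact mul_mem (ha Q hQ φ) (hb Q hQ φ)
  inv_mem' ha Q _ _ hQ φ := by rw [map_inv]; exact inv_mem (ha Q hQ φ)

variable {p}

theorem mem_pClosure_self (x : F) : x ∈ pClosure p x :=
  fun _ _ _ _ _ => Subgroup.mem_zpowers _

theorem mem_pClosure_one {z : F} : z ∈ pClosure p (1 : F) ↔
    ∀ (Q : Type) [Group Q] [Finite Q], IsPGroup p Q → ∀ φ : F →* Q, φ z = 1 := by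
  change (∀ (Q : Type) [Group Q] [Finite Q], IsPGroup p Q → _) ↔ _
  simp only [map_one, Subgroup.zpowers_one_eq_bot, Subgroup.mem_bot]

theorem IsPGroup.prod {G H : Type} [Group G] [Group H] (hG : IsPGroup p G) (hH : IsPGroup p H) :
    IsPGroup p (G × H) := by
  rintro ⟨a, b⟩
  obtain ⟨i, hi⟩ := hG a
  obtain ⟨j, hj⟩ := hH b
  refine ⟨i + j, Prod.ext ?_ ?_⟩
  · rw [Prod.pow_fst, pow_add, pow_mul, hi, one_pow]; rfl
  · rw [Prod.pow_snd, pow_add, mul_comm, pow_mul, hj, one_pow]; rfl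

/-- Finitely many elements can be separated simultaneously from closures of cyclic subgroups. -/
theorem exists_hom_forall_notMem_zpowers (T : Finset (F × F))
    (hT : ∀ a ∈ T, a.1 ∉ pClosure p a.2) :
    ∃ (Q : Type) (_ : Group Q) (_ : Finite Q) (φ : F →* Q), IsPGroup p Q ∧
      ∀ a ∈ T, φ a.1 ∉ Subgroup.zpowers (φ a.2) := by
  classical
  induction T using Finset.induction_on with
  | empty =>
    exact ⟨PUnit, inferInstance, inferInstance, 1, IsPGroup.of_subsingleton _ _, by simp⟩
  | insert a T ha ih =>
    obtain ⟨Q, _, _, φ, hQ, hφ⟩ := ih fun b hb => hT b (Finset.mem_insert_of_mem hb)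
    have h1 := hT a (Finset.mem_insert_self a T)
    change ¬ ∀ (Q : Type) [Group Q] [Finite Q], IsPGroup p Q → _ at h1
    push Not at h1
    obtain ⟨Q', _, _, hQ', φ', hφ'⟩ := h1
    refine ⟨Q × Q', inferInstance, inferInstance, φ.prod φ', hQ.prod hQ', fun b hb hmem => ?_⟩
    rw [Subgroup.mem_zpowers_iff] at hmem
    obtain ⟨i, hi⟩ := hmem
    rw [Prod.ext_iff] at hi
    rcases Finset.mem_insert.mp hb with rfl | hb
    · exact hφ' ⟨i, hi.2⟩
    · exact hφ b hb ⟨i, hi.1⟩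

end Separation

open Classical in
/-- A nonzero coset sum over the pro-`p` closure of a cyclic subgroup is seen in a finite
`p`-quotient, which may moreover be chosen to realise finitely many separations. -/
theorem exists_hom_foxPairing_ne_zero {S : Type} {p : ℕ} (hp : p.Prime) (x z u : FreeGroup S)
    (s : S)
    (hb : foxPairing s z (fun v => if v * u⁻¹ ∈ pClosure p x then (1 : ℤ) else 0) ≠ 0)
    (T : Finset (FreeGroup S × FreeGroup S)) (hT : ∀ a ∈ T, a.1 ∉ pClosure p a.2) :
    ∃ (Q : Type) (_ : Group Q) (_ : Finite Q) (φ : FreeGroup S →* Q) (j : ℕ), IsPGroup p Q ∧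
      (∀ a ∈ T, φ a.1 ∉ Subgroup.zpowers (φ a.2)) ∧
      foxPairing s z (fun v => if φ v * (φ u)⁻¹ ∈ Subgroup.zpowers (φ x)
        then (1 : ZMod (p ^ j)) else 0) ≠ 0 := by
  set b := foxPairing s z (fun v => if v * u⁻¹ ∈ pClosure p x then (1 : ℤ) else 0) with hbdef
  let T' : Finset (FreeGroup S × FreeGroup S) :=
    (((foxDerivative s z).support.image fun v => (v * u⁻¹, x)).filter
      fun a => a.1 ∉ pClosure p a.2) ∪ T
  obtain ⟨Q, _, _, φ, hQ, hφ⟩ := exists_hom_forall_notMem_zpowers (p := p) T' fun a ha => by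
    rcases Finset.mem_union.mp ha with h | h
    · exact (Finset.mem_filter.mp h).2
    · exact hT a h
  refine ⟨Q, _, inferInstance, φ, b.natAbs, hQ,
    fun a ha => hφ a (Finset.mem_union_right _ ha), ?_⟩
  have key : foxPairing s z (fun v => if φ v * (φ u)⁻¹ ∈ Subgroup.zpowers (φ x)
        then (1 : ZMod (p ^ b.natAbs)) else 0) = ((b : ℤ) : ZMod (p ^ b.natAbs)) := by
    rw [hbdef, foxPairing, foxPairing, Finsupp.linearCombination_apply,
      Finsupp.linearCombination_apply, Finsupp.sum, Finsupp.sum, Int.cast_sum]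
    refine Finset.sum_congr rfl fun v hv => ?_
    have hiff : φ v * (φ u)⁻¹ ∈ Subgroup.zpowers (φ x) ↔ v * u⁻¹ ∈ pClosure p x := by
      rw [← map_inv, ← map_mul]
      constructor
      · intro h
        by_contra hn
        exact hφ (v * u⁻¹, x) (Finset.mem_union_left _ (Finset.mem_filter.mpr
          ⟨Finset.mem_image_of_mem _ hv, hn⟩)) h
      · intro h
        exact h Q hQ φ
    by_cases h : v * u⁻¹ ∈ pClosure p x
    · simp [hiff, h]
    · simp [hiff, h]
  rw [key, Ne, ZMod.intCast_zmod_eq_zero_iff_dvd]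
  intro hdvd
  rw [Int.natCast_dvd] at hdvd
  exact absurd (Nat.le_of_dvd (Int.natAbs_pos.mpr hb) hdvd)
    (not_le.mpr (Nat.lt_pow_self hp.one_lt))

theorem exists_freeGroup_mulEquiv (F : Type) [Group F] [IsFreeGroup F] :
    ∃ S : Type, Nonempty (F ≃* FreeGroup S) :=
  ⟨_, ⟨IsFreeGroup.toFreeGroup F⟩⟩

theorem FreeGroup.of_mul_of_ne {S : Type} {a b : S} (hab : a ≠ b) :
    FreeGroup.of a * FreeGroup.of b ≠ FreeGroup.of b * FreeGroup.of a := by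
  classical
  intro h
  have := congrArg (FreeGroup.lift fun t => if t = a then (Equiv.swap 0 1 : Equiv.Perm (Fin 3))
    else Equiv.swap 1 2) h
  simp only [_root_.map_mul, FreeGroup.lift_apply_of, if_true, if_neg hab.symm] at this
  revert this
  decide

theorem FreeGroup.eq_of_zpow {S : Type} [Subsingleton S] (a : S) (x : FreeGroup S) :
    ∃ k : ℤ, x = FreeGroup.of a ^ k := by
  induction x using FreeGroup.induction_on with
  | C1 => exact ⟨0, by simp⟩
  | of t => exact ⟨1, by simp [Subsingleton.elim t a]⟩
  | inv_of t _ => exact ⟨-1, by simp [Subsingleton.elim t a]⟩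
  | mul x y hx hy =>
    obtain ⟨i, rfl⟩ := hx
    obtain ⟨j, rfl⟩ := hy
    exact ⟨i + j, (zpow_add _ _ _).symm⟩

/-- A nontrivial commutative free group is infinite cyclic. -/
theorem exists_zpow_of_commutative {F : Type} [Group F] [IsFreeGroup F]
    (hc : ∀ a b : F, a * b = b * a) {x : F} (hx : x ≠ 1) :
    ∃ (w : F) (η : F →* Multiplicative ℤ), η w = Multiplicative.ofAdd 1 ∧
      ∀ y, ∃ k : ℤ, y = w ^ k := by
  obtain ⟨S, ⟨e⟩⟩ := exists_freeGroup_mulEquiv F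
  have hS : Subsingleton S := ⟨fun a b => by
    by_contra hab
    apply FreeGroup.of_mul_of_ne hab
    apply e.symm.injective
    rw [map_mul, map_mul, hc]⟩
  have hne : Nonempty S := by
    by_contra h
    rw [not_nonempty_iff] at h
    exact hx (e.injective (Subsingleton.elim _ _))
  obtain ⟨a⟩ := hne
  refine ⟨e.symm (FreeGroup.of a),
    (FreeGroup.lift fun _ => Multiplicative.ofAdd 1).comp e.toMonoidHom, by simp, fun y => ?_⟩
  obtain ⟨k, hk⟩ := FreeGroup.eq_of_zpow a (e y)
  exact ⟨k, by rw [← map_zpow, ← hk, e.symm_apply_apply]⟩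

/-- Free groups are residually `p`. -/
theorem pClosure_one_eq_bot {S : Type} {p : ℕ} (hp : p.Prime) :
    pClosure p (1 : FreeGroup S) = ⊥ := by
  classical
  by_contra hne
  obtain ⟨S', ⟨e⟩⟩ := exists_freeGroup_mulEquiv (pClosure p (1 : FreeGroup S))
  have hS' : Nonempty S' := by
    by_contra h
    rw [not_nonempty_iff] at h
    exact hne ((Subgroup.eq_bot_iff_forall _).mpr fun x hx =>
      congrArg Subtype.val (e.injective (Subsingleton.elim (e ⟨x, hx⟩) (e 1))))
  obtain ⟨a⟩ := hS'
  obtain ⟨s, u, hb⟩ := exists_foxPairing_coset_ne_zero (pClosure p (1 : FreeGroup S))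
    ((FreeGroup.lift fun _ => Multiplicative.ofAdd (1 : ℤ)).comp e.toMonoidHom)
    (e.symm (FreeGroup.of a)) (by
      simp only [MonoidHom.comp_apply, MulEquiv.coe_toMonoidHom, MulEquiv.apply_symm_apply,
        FreeGroup.lift_apply_of]
      decide)
  set z := e.symm (FreeGroup.of a)
  obtain ⟨Q, _, _, φ, j, hQ, -, hφ⟩ := exists_hom_foxPairing_ne_zero hp 1 (z : FreeGroup S) u s
    hb ∅ (by simp)
  apply hφ
  have : NeZero (p ^ j) := ⟨pow_ne_zero _ hp.ne_zero⟩
  have h1 : MagnusGroup.lift (k := ZMod (p ^ j)) φ s (z : FreeGroup S) = 1 :=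
    mem_pClosure_one.mp z.2 _ (MagnusGroup.isPGroup hQ) _
  have h2 := linearCombination_lift_chain (k := ZMod (p ^ j)) s φ (z : FreeGroup S)
    (fun q => if q * (φ u)⁻¹ ∈ Subgroup.zpowers (φ 1) then (1 : ZMod (p ^ j)) else 0)
  rw [h1, MagnusGroup.one_chain, map_zero] at h2
  exact h2.symm

theorem commute_of_mem_pClosure {S : Type} {p : ℕ} (hp : p.Prime) {x a b : FreeGroup S}
    (ha : a ∈ pClosure p x) (hb : b ∈ pClosure p x) : a * b = b * a := by
  have h : a * b * (b * a)⁻¹ ∈ pClosure p (1 : FreeGroup S) := mem_pClosure_one.mpr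
    fun Q _ _ hQ φ => by
      obtain ⟨i, hi⟩ := ha Q hQ φ
      obtain ⟨j, hj⟩ := hb Q hQ φ
      rw [map_mul, map_inv, mul_inv_eq_one, map_mul, map_mul, ← hi, ← hj, ← zpow_add,
        ← zpow_add, add_comm]
  rw [pClosure_one_eq_bot hp, Subgroup.mem_bot, mul_inv_eq_one] at h
  exact h

theorem foxPairing_conj {S M : Type} [AddCommGroup M] (s : S) (g x : FreeGroup S)
    (ψ : FreeGroup S → M) (hψ : ∀ v, ψ (g * x * g⁻¹ * v) = ψ v) :
    foxPairing s (g * x * g⁻¹) ψ = foxPairing s x (fun v => ψ (g * v)) := by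
  rw [foxPairing_mul, foxPairing_mul, foxPairing_inv]
  simp only [← mul_assoc, hψ]
  abel

/-- Free groups are `p`-conjugacy separable. -/
theorem conjSepC_freeGroup {S : Type} {p : ℕ} (hp : p.Prime) : ConjSepC (CP p) (FreeGroup S) := by
  classical
  intro x y hxy
  by_contra! hcon
  have hconj : ∀ (Q : Type) [Group Q] [Finite Q], IsPGroup p Q → ∀ φ : FreeGroup S →* Q,
      ∃ g, φ (g * x * g⁻¹) = φ y := by
    intro Q _ _ hQ φ
    have h := hcon (GrpB.of φ.range) ⟨inferInstanceAs (Finite φ.range), hQ.to_subgroup φ.range⟩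
      φ.rangeRestrict
    obtain ⟨⟨c, g, rfl⟩, hc⟩ := isConj_iff.mp h
    refine ⟨g, ?_⟩
    rw [map_mul, map_mul, map_inv]
    exact congrArg Subtype.val hc
  have hx : x ≠ 1 := by
    rintro rfl
    apply hxy
    have : y ∈ pClosure p (1 : FreeGroup S) := mem_pClosure_one.mpr fun Q _ _ hQ φ => by
      obtain ⟨g, hg⟩ := hconj Q hQ φ
      rw [← hg]; simp
    rw [pClosure_one_eq_bot hp, Subgroup.mem_bot] at this
    rw [this]
  obtain ⟨w, η, hw, hwk⟩ := exists_zpow_of_commutative (F := pClosure p x)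
    (fun a b => Subtype.ext (commute_of_mem_pClosure hp a.2 b.2))
    (x := ⟨x, mem_pClosure_self x⟩) (fun h => hx (congrArg Subtype.val h))
  have hη : η ⟨x, mem_pClosure_self x⟩ ≠ 1 := by
    intro h
    obtain ⟨k, hk⟩ := hwk ⟨x, mem_pClosure_self x⟩
    rw [hk, map_zpow, hw, ← ofAdd_zsmul, ofAdd_eq_one] at h
    have hk0 : k = 0 := by simpa using h
    rw [hk0, zpow_zero] at hk
    exact hx (congrArg Subtype.val hk)
  obtain ⟨s, u, hb⟩ := exists_foxPairing_coset_ne_zero (pClosure p x) η _ hη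
  obtain ⟨Q, _, _, φ, j, hQ, hsep, hφ⟩ := exists_hom_foxPairing_ne_zero hp x x u s hb
    ((foxDerivative s y).support.image fun v => (v * u⁻¹ * x * (v * u⁻¹)⁻¹ * y⁻¹, 1)) (by
      intro a ha
      obtain ⟨v, -, rfl⟩ := Finset.mem_image.mp ha
      rw [pClosure_one_eq_bot hp, Subgroup.mem_bot, mul_inv_eq_one]
      exact fun h => hxy (isConj_iff.mpr ⟨_, h⟩))
  have : NeZero (p ^ j) := ⟨pow_ne_zero _ hp.ne_zero⟩
  obtain ⟨g, hg⟩ := hconj _ (MagnusGroup.isPGroup (j := j) hQ)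
    (MagnusGroup.lift (k := ZMod (p ^ j)) φ s)
  have hgφ : φ g * φ x * (φ g)⁻¹ = φ y := by
    have := congrArg MagnusGroup.val hg
    simpa using this
  let ψ : Q → ZMod (p ^ j) := fun q =>
    if q * (φ (g * u))⁻¹ ∈ Subgroup.zpowers (φ y) then 1 else 0
  have h1 : foxPairing s (g * x * g⁻¹) (fun v => ψ (φ v)) = foxPairing s y (fun v => ψ (φ v)) := by
    rw [← linearCombination_lift_chain, ← linearCombination_lift_chain, hg]
  rw [foxPairing_conj] at h1
  · have h2 : (fun v => ψ (φ (g * v))) = fun v =>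
        if φ v * (φ u)⁻¹ ∈ Subgroup.zpowers (φ x) then (1 : ZMod (p ^ j)) else 0 := by
      funext v
      simp only [ψ, map_mul, ← hgφ]
      congr 1
      rw [eq_iff_iff, Subgroup.mem_zpowers_iff, Subgroup.mem_zpowers_iff]
      refine exists_congr fun i => ?_
      rw [conj_zpow, mul_inv_rev, ← mul_assoc, mul_left_inj, mul_assoc, mul_right_inj]
    rw [h2] at h1
    rw [h1] at hφ
    apply hφ
    rw [foxPairing, Finsupp.linearCombination_apply]
    refine Finset.sum_eq_zero fun v hv => ?_
    have h3 : φ v * (φ (g * u))⁻¹ ∉ Subgroup.zpowers (φ y) := by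
      intro h
      obtain ⟨i, hi⟩ := h
      simp only [map_mul] at hi
      refine hsep _ (Finset.mem_image_of_mem _ hv) ?_
      have h4 : φ (v * u⁻¹) = φ y ^ i * φ g := by
        rw [hi, map_mul, map_inv]; group
      have h5 : φ (v * u⁻¹ * x * (v * u⁻¹)⁻¹ * y⁻¹) = 1 := by
        rw [map_mul, map_mul, map_mul, map_inv, map_inv, h4, mul_inv_eq_one]
        calc φ y ^ i * φ g * φ x * (φ y ^ i * φ g)⁻¹
            = φ y ^ i * (φ g * φ x * (φ g)⁻¹) * (φ y ^ i)⁻¹ := by group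
          _ = φ y := by rw [hgφ]; group
      rw [h5]
      exact one_mem _
    simp only [ψ, if_neg h3, smul_zero]
  · intro v
    simp only [ψ, map_mul, map_inv, hgφ]
    congr 1
    rw [eq_iff_iff, mul_assoc, Subgroup.mul_mem_cancel_left _ (Subgroup.mem_zpowers _)]

theorem mul_comm_of_mem_closure {G : Type} [Group G] {s : Set G}
    (h : ∀ a ∈ s, ∀ b ∈ s, a * b = b * a) {a b : G} (ha : a ∈ Subgroup.closure s)
    (hb : b ∈ Subgroup.closure s) : a * b = b * a := by
  have h1 : s ⊆ Subgroup.centralizer s := fun x hx => Subgroup.mem_centralizer_iff.mpr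
    fun y hy => h y hy x hx
  have h2 : Subgroup.closure s ≤ Subgroup.centralizer s := (Subgroup.closure_le _).mpr h1
  have h3 : s ⊆ Subgroup.centralizer (Subgroup.closure s : Set G) := fun x hx =>
    Subgroup.mem_centralizer_iff.mpr fun y hy =>
      (Subgroup.mem_centralizer_iff.mp (h2 hy) x hx).symm
  exact Subgroup.mem_centralizer_iff.mp ((Subgroup.closure_le _).mpr h3 hb) a ha

theorem mul_comm_of_mem_closure_pair {G : Type} [Group G] {x y : G} (h : x * y = y * x) {a b : G}
    (ha : a ∈ Subgroup.closure {x, y}) (hb : b ∈ Subgroup.closure {x, y}) : a * b = b * a := by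
  refine mul_comm_of_mem_closure (s := {x, y}) ?_ ha hb
  rintro a (rfl | rfl) b (rfl | rfl)
  · rfl
  · exact h
  · exact h.symm
  · rfl

/-- Commuting elements of a free group are powers of a common element. -/
theorem exists_zpow_eq_of_commute {F : Type} [Group F] [IsFreeGroup F] {x y : F}
    (h : Commute x y) : ∃ (w : F) (i j : ℤ), x = w ^ i ∧ y = w ^ j := by
  by_cases hx : x = 1
  · exact ⟨y, 0, 1, by simp [hx], by simp⟩
  · obtain ⟨w, -, -, hw⟩ := exists_zpow_of_commutative (F := Subgroup.closure {x, y})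
      (fun a b => Subtype.ext (mul_comm_of_mem_closure_pair h a.2 b.2))
      (x := ⟨x, Subgroup.subset_closure (by simp)⟩) (fun h => hx (congrArg Subtype.val h))
    obtain ⟨i, hi⟩ := hw ⟨x, Subgroup.subset_closure (by simp)⟩
    obtain ⟨j, hj⟩ := hw ⟨y, Subgroup.subset_closure (by simp)⟩
    exact ⟨w, i, j, congrArg Subtype.val hi, congrArg Subtype.val hj⟩

theorem exists_zpow_of_commute_of {S : Type} {a : S} {z : FreeGroup S}
    (h : Commute z (FreeGroup.of a)) : ∃ k : ℤ, z = FreeGroup.of a ^ k := by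
  classical
  obtain ⟨w, i, j, rfl, hj⟩ := exists_zpow_eq_of_commute h
  have h1 := congrArg (fun x => (FreeGroup.lift (fun _ : S => Multiplicative.ofAdd (1 : ℤ)) x).toAdd)
    hj
  simp only [FreeGroup.lift_apply_of, map_zpow, toAdd_zpow, toAdd_ofAdd, smul_eq_mul] at h1
  rcases Int.isUnit_iff.mp (IsUnit.of_mul_eq_one _ h1.symm) with rfl | rfl
  · exact ⟨i, by rw [hj, zpow_one]⟩
  · exact ⟨-i, by rw [hj, ← zpow_mul]; simp⟩

theorem eq_one_of_commute_of {S : Type} {a b : S} (hab : a ≠ b) {z : FreeGroup S}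
    (ha : Commute z (FreeGroup.of a)) (hb : Commute z (FreeGroup.of b)) : z = 1 := by
  classical
  obtain ⟨k, rfl⟩ := exists_zpow_of_commute_of ha
  obtain ⟨l, hl⟩ := exists_zpow_of_commute_of hb
  have h1 := congrArg (fun x => (FreeGroup.lift
    (fun t : S => Multiplicative.ofAdd (if t = a then (1 : ℤ) else 0)) x).toAdd) hl
  simp [hab.symm] at h1
  rw [h1, zpow_zero]

theorem FreeGroup.mul_comm_of_subsingleton {S : Type} [Subsingleton S] (x y : FreeGroup S) :
    x * y = y * x := by
  rcases isEmpty_or_nonempty S with h | ⟨⟨a⟩⟩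
  · exact Subsingleton.elim _ _
  · obtain ⟨i, rfl⟩ := FreeGroup.eq_of_zpow a x
    obtain ⟨j, rfl⟩ := FreeGroup.eq_of_zpow a y
    rw [← zpow_add, ← zpow_add, add_comm]

/-- Centralizers of nontrivial elements in free groups are commutative. -/
theorem commute_of_commute_ne_one {F : Type} [Group F] [IsFreeGroup F] {u x y : F} (hu : u ≠ 1)
    (hx : Commute x u) (hy : Commute y u) : Commute x y := by
  obtain ⟨S, ⟨e⟩⟩ := exists_freeGroup_mulEquiv (Subgroup.centralizer {u})
  have hmem : ∀ {z}, Commute z u → z ∈ Subgroup.centralizer {u} := fun {z} hz =>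
    Subgroup.mem_centralizer_singleton_iff.mpr hz
  let u' : Subgroup.centralizer {u} := ⟨u, hmem (Commute.refl u)⟩
  have hcen : ∀ g, Commute (e u') g := fun g => by
    obtain ⟨g, rfl⟩ := e.surjective g
    exact Commute.map (Subtype.ext (Subgroup.mem_centralizer_singleton_iff.mp g.2).symm) e
  have hS : Subsingleton S := ⟨fun a b => by
    by_contra hab
    apply hu
    have := eq_one_of_commute_of hab (hcen _) (hcen _)
    exact congrArg Subtype.val (e.map_eq_one_iff.mp this)⟩
  have := FreeGroup.mul_comm_of_subsingleton (e ⟨x, hmem hx⟩) (e ⟨y, hmem hy⟩)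
  rw [← map_mul, ← map_mul] at this
  exact congrArg Subtype.val (e.injective this)

/-- The centralizer of a nontrivial element of a free group is infinite cyclic. -/
theorem exists_root_of_ne_one {F : Type} [Group F] [IsFreeGroup F] {u : F} (hu : u ≠ 1) :
    ∃ (w : F) (m : ℕ), m ≠ 0 ∧ u = w ^ m ∧ ∀ x, Commute x u → ∃ k : ℤ, x = w ^ k := by
  have hmem : ∀ {z}, Commute z u → z ∈ Subgroup.centralizer {u} := fun {z} hz =>
    Subgroup.mem_centralizer_singleton_iff.mpr hz
  obtain ⟨w, -, -, hw⟩ := exists_zpow_of_commutative (F := Subgroup.centralizer {u})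
    (fun a b => Subtype.ext (commute_of_commute_ne_one hu
      (Subgroup.mem_centralizer_singleton_iff.mp a.2)
      (Subgroup.mem_centralizer_singleton_iff.mp b.2)))
    (x := ⟨u, hmem (Commute.refl u)⟩) (fun h => hu (congrArg Subtype.val h))
  obtain ⟨m, hm⟩ := hw ⟨u, hmem (Commute.refl u)⟩
  have hm' : u = (w : F) ^ m := congrArg Subtype.val hm
  have hw' : ∀ x, Commute x u → ∃ k : ℤ, x = (w : F) ^ k := fun x hx => by
    obtain ⟨k, hk⟩ := hw ⟨x, hmem hx⟩
    exact ⟨k, congrArg Subtype.val hk⟩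
  have hm0 : m ≠ 0 := by
    rintro rfl
    exact hu (by simpa using hm')
  rcases Int.natAbs_eq m with h | h
  · exact ⟨w, m.natAbs, Int.natAbs_ne_zero.mpr hm0, by rw [← zpow_natCast, ← h]; exact hm', hw'⟩
  · refine ⟨(w : F)⁻¹, m.natAbs, Int.natAbs_ne_zero.mpr hm0, ?_, fun x hx => ?_⟩
    · rw [← zpow_natCast, inv_zpow', ← h]; exact hm'
    · obtain ⟨k, hk⟩ := hw' x hx
      exact ⟨-k, by rw [inv_zpow', neg_neg, hk]⟩

theorem mapDomain_neg {α β : Type} (f : α → β) (c : α →₀ ℤ) :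
    (-c).mapDomain f = -c.mapDomain f :=
  map_neg (Finsupp.mapDomain.addMonoidHom f) c

/-- Over a nontrivial commutative quotient, some commutator in a noncommutative free group has a
Magnus chain not fixed by any nontrivial translation. -/
theorem exists_commutator_chain_ne {S D : Type} [Group D] (hD : ∀ a b : D, a * b = b * a)
    (χ : FreeGroup S →* D) (hχ : χ ≠ 1) (hS : ∃ x y : FreeGroup S, x * y ≠ y * x) :
    ∃ (c : S) (x y : FreeGroup S), ∀ ω : D, ω ≠ 1 → (MagnusGroup.lift (k := ℤ) χ c (x * y * x⁻¹ * y⁻¹)).chain.mapDomain (ω * ·) ≠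
      (MagnusGroup.lift (k := ℤ) χ c (x * y * x⁻¹ * y⁻¹)).chain := by
  classical
  obtain ⟨b, hb⟩ : ∃ b, χ (FreeGroup.of b) ≠ 1 := by
    by_contra! h
    exact hχ (FreeGroup.ext_hom _ _ h)
  obtain ⟨c, hc⟩ : ∃ c, b ≠ c := by
    by_contra! h
    have : Subsingleton S := ⟨fun x y => (h x).symm.trans (h y)⟩
    obtain ⟨x, y, hxy⟩ := hS
    exact hxy (FreeGroup.mul_comm_of_subsingleton x y)
  refine ⟨c, FreeGroup.of b, FreeGroup.of c, fun ω hω h => ?_⟩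
  have hchain : (MagnusGroup.lift (k := ℤ) χ c (FreeGroup.of b *
      FreeGroup.of c * (FreeGroup.of b)⁻¹ * (FreeGroup.of c)⁻¹)).chain =
      Finsupp.single (χ (FreeGroup.of b)) 1 - Finsupp.single 1 1 := by
    have hcom : χ (FreeGroup.of b) * χ (FreeGroup.of c) * (χ (FreeGroup.of b))⁻¹ *
        (χ (FreeGroup.of c))⁻¹ = 1 := by rw [hD (χ (FreeGroup.of b))]; group
    simp only [map_mul, map_inv, mul_chain, inv_chain, mul_val, inv_val,
      lift_val, lift_of_chain, if_neg hc, if_true, Finsupp.mapDomain_zero, neg_zero,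
      Finsupp.mapDomain_single, mul_one, zero_add, add_zero, mapDomain_neg]
    rw [hcom, sub_eq_add_neg]
  rw [hchain, sub_eq_add_neg, Finsupp.mapDomain_add, mapDomain_neg,
    Finsupp.mapDomain_single, Finsupp.mapDomain_single] at h
  have h1 := DFunLike.congr_fun h 1
  simp only [Finsupp.add_apply, Finsupp.neg_apply, Finsupp.single_apply, mul_one, if_neg hω,
    if_neg hb, if_true] at h1
  split_ifs at h1 <;> omega

/-- The elements lying over `t` whose centralizer maps onto something containing `γ` differ by
elements of a subgroup of infinite index in the kernel. -/
theorem exists_not_finiteIndex_of_commute {F P : Type} [Group F] [IsFreeGroup F] [Group P]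
    (ρ : F →* P) (hρ : Function.Surjective ρ) (hN : ∃ x ∈ ρ.ker, ∃ y ∈ ρ.ker, x * y ≠ y * x)
    {t γ : P} (htγ : t * γ = γ * t) (hγ : γ ∉ Subgroup.zpowers t) :
    ∃ K : Subgroup ρ.ker, ¬ K.FiniteIndex ∧ ∀ u w u' w' : F, ρ u = t → ρ w = γ → ρ w' = γ →
      Commute w u → Commute w' u' → ∀ n : ρ.ker, u' = u * n → n ∈ K := by
  set A := Subgroup.closure {t, γ} with hA
  have htA : t ∈ A := Subgroup.subset_closure (by simp)
  have hγA : γ ∈ A := Subgroup.subset_closure (by simp)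
  have hAc : ∀ a b : A, a * b = b * a := fun a b =>
    Subtype.ext (mul_comm_of_mem_closure_pair htγ a.2 b.2)
  let T : Subgroup A := Subgroup.zpowers ⟨t, htA⟩
  have hTn : T.Normal := ⟨fun n hn g => by rwa [hAc g, mul_inv_cancel_right]⟩
  let H : Subgroup F := A.comap ρ
  let ρH : H →* A := (ρ.comp H.subtype).codRestrict A fun x => x.2
  obtain ⟨S, ⟨e⟩⟩ := exists_freeGroup_mulEquiv H
  let χ : FreeGroup S →* A ⧸ T := ((QuotientGroup.mk' T).comp ρH).comp e.symm.toMonoidHom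
  have hχ : ∀ (x : F) (hx : ρ x ∈ A), χ (e ⟨x, hx⟩) = QuotientGroup.mk' T ⟨ρ x, hx⟩ :=
    fun x hx => by
      simp only [χ, MonoidHom.comp_apply, MulEquiv.coe_toMonoidHom, MulEquiv.symm_apply_apply]
      rfl
  set ω : A ⧸ T := QuotientGroup.mk' T ⟨γ, hγA⟩ with hωdef
  have hω : ω ≠ 1 := fun h => by
    obtain ⟨i, hi⟩ := (QuotientGroup.eq_one_iff _).mp h
    exact hγ ⟨i, congrArg Subtype.val hi⟩
  have hD : ∀ a b : A ⧸ T, a * b = b * a := fun a b => by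
    obtain ⟨a, rfl⟩ := QuotientGroup.mk'_surjective T a
    obtain ⟨b, rfl⟩ := QuotientGroup.mk'_surjective T b
    rw [← map_mul, ← map_mul, hAc]
  have hker : ∀ n : ρ.ker, ρ n ∈ A := fun n => by
    rw [MonoidHom.mem_ker.mp n.2]; exact one_mem A
  have hχ1 : χ ≠ 1 := fun h => by
    obtain ⟨w, hw⟩ := hρ γ
    have h1 := hχ w (by rw [hw]; exact hγA)
    apply hω
    rw [h] at h1
    simp only [hw] at h1
    exact h1.symm
  obtain ⟨c, x, y, hcxy⟩ := exists_commutator_chain_ne hD χ hχ1 (by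
    obtain ⟨x, hx, y, hy, hxy⟩ := hN
    refine ⟨e ⟨x, hker ⟨x, hx⟩⟩, e ⟨y, hker ⟨y, hy⟩⟩, fun h => hxy ?_⟩
    rw [← map_mul, ← map_mul] at h
    exact congrArg Subtype.val (e.injective h))
  let μ : H →* MagnusGroup ℤ (A ⧸ T) := (MagnusGroup.lift (k := ℤ) χ c).comp e.toMonoidHom
  have hμval : ∀ (x : F) (hx : ρ x ∈ A), (μ ⟨x, hx⟩).val = QuotientGroup.mk' T ⟨ρ x, hx⟩ :=
    fun x hx => by
      rw [← hχ]
      exact lift_val _ _ _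
  let ν : ρ.ker →* MagnusGroup ℤ (A ⧸ T) :=
    μ.comp (Subgroup.inclusion (K := H) fun n hn => hker ⟨n, hn⟩)
  have hνval : ∀ n, (ν n).val = 1 := fun n => by
    refine (hμval n (hker n)).trans ?_
    rw [← map_one (QuotientGroup.mk' T)]
    congr 1
    exact Subtype.ext (MonoidHom.mem_ker.mp n.2)
  let K : Subgroup ρ.ker :=
    { carrier := {n | (ν n).chain.mapDomain (ω * ·) = (ν n).chain}
      one_mem' := by simp
      mul_mem' := fun {a b} ha hb => by
        simp only [Set.mem_ofPred_eq] at ha hb ⊢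
        rw [map_mul, mul_chain, hνval, mapDomain_one_mul, Finsupp.mapDomain_add, ha, hb]
      inv_mem' := fun {a} ha => by
        simp only [Set.mem_ofPred_eq] at ha ⊢
        rw [map_inv, inv_chain, hνval, inv_one, mapDomain_one_mul, mapDomain_neg, ha] }
  refine ⟨K, fun hK => ?_, ?_⟩
  · have hcomm : ρ ((e.symm (x * y * x⁻¹ * y⁻¹) : H) : F) = 1 := by
      have h1 : ρH (e.symm (x * y * x⁻¹ * y⁻¹)) = 1 := by
        rw [map_mul, map_mul, map_mul, map_inv, map_inv, map_mul, map_mul,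
          map_mul, map_inv, map_inv, hAc (ρH (e.symm x))]
        group
      exact congrArg Subtype.val h1
    obtain ⟨k, hk, -, hmem⟩ := Subgroup.exists_pow_mem_of_index_ne_zero hK.index_ne_zero
      (⟨_, hcomm⟩ : ρ.ker)
    apply hcxy ω hω
    have h1 : (ν (⟨_, hcomm⟩ ^ k)).chain.mapDomain (ω * ·) = (ν (⟨_, hcomm⟩ ^ k)).chain := hmem
    have h2 : ν ⟨_, hcomm⟩ = MagnusGroup.lift (k := ℤ) χ c (x * y * x⁻¹ * y⁻¹) := by
      change MagnusGroup.lift (k := ℤ) χ c (e (e.symm (x * y * x⁻¹ * y⁻¹))) = _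
      rw [e.apply_symm_apply]
    rw [map_pow, pow_chain_of_val_eq_one (hνval _), h2, Finsupp.mapDomain_smul] at h1
    exact smul_right_injective _ hk.ne' h1
  · intro u w u' w' hu hw hw' hc hc' n hn
    have hHt : ∀ {u}, ρ u = t → ρ u ∈ A := fun hu => by rwa [hu]
    have hHγ : ∀ {w}, ρ w = γ → ρ w ∈ A := fun hw => by rwa [hw]
    have hfix : ∀ (u w : F) (hu : ρ u = t) (hw : ρ w = γ), Commute w u →
        (μ ⟨u, hHt hu⟩).chain.mapDomain (ω * ·) = (μ ⟨u, hHt hu⟩).chain := by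
      intro u w hu hw hc
      have h1 : (⟨w, hHγ hw⟩ * ⟨u, hHt hu⟩ : H) =
        ⟨u, hHt hu⟩ * ⟨w, hHγ hw⟩ := Subtype.ext hc
      have h2 := congrArg (fun x => (μ x).chain) h1
      have hvu : (μ ⟨u, hHt hu⟩).val = 1 := by
        rw [hμval]
        simp only [hu]
        exact (QuotientGroup.eq_one_iff _).mpr (Subgroup.mem_zpowers _)
      have hvw : (μ ⟨w, hHγ hw⟩).val = ω := by
        rw [hμval]
        simp only [hw]
        rfl
      simp only [map_mul, mul_chain, hvu, hvw, mapDomain_one_mul] at h2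
      rw [add_comm] at h2
      exact add_right_cancel h2
    have hu' : ρ u' = t := by rw [hn, map_mul, hu, MonoidHom.mem_ker.mp n.2, mul_one]
    have e1 := hfix u w hu hw hc
    have e2 := hfix u' w' hu' hw' hc'
    have h3 : (⟨u', hHt hu'⟩ : H) = ⟨u, hHt hu⟩ * ⟨n, hker n⟩ := Subtype.ext hn
    have hvu : (μ ⟨u, hHt hu⟩).val = 1 := by
      rw [hμval]
      simp only [hu]
      exact (QuotientGroup.eq_one_iff _).mpr (Subgroup.mem_zpowers _)
    rw [h3, map_mul, mul_chain, hvu, mapDomain_one_mul, Finsupp.mapDomain_add, e1] at e2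
    exact add_left_cancel e2

/-- An element `t` lifts to an element of the free group whose centralizer avoids finitely many
prescribed elements that are not powers of `t`. -/
theorem exists_lift_forall_commute_notMem {F P : Type} [Group F] [IsFreeGroup F] [Group P]
    (ρ : F →* P) (hρ : Function.Surjective ρ) (hN : ∃ x ∈ ρ.ker, ∃ y ∈ ρ.ker, x * y ≠ y * x)
    (t : P) (Γ : Finset P) (hΓ : ∀ γ ∈ Γ, t * γ = γ * t ∧ γ ∉ Subgroup.zpowers t) :
    ∃ u, ρ u = t ∧ ∀ w, Commute w u → ρ w ∉ Γ := by
  classical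
  by_contra! hcon
  obtain ⟨g, hg⟩ := hρ t
  choose! K hK hKmem using fun γ (hγ : γ ∈ Γ) =>
    exists_not_finiteIndex_of_commute ρ hρ hN (hΓ γ hγ).1 (hΓ γ hγ).2
  let r : P → ρ.ker := fun γ =>
    if h : ∃ n : ρ.ker, ∃ w, Commute w (g * n) ∧ ρ w = γ then h.choose else 1
  have hr : ∀ γ (n : ρ.ker) w, Commute w (g * n) → ρ w = γ →
      ∃ w', Commute w' (g * r γ) ∧ ρ w' = γ := by
    intro γ n w hw hγ
    have h : ∃ n : ρ.ker, ∃ w, Commute w (g * n) ∧ ρ w = γ := ⟨n, w, hw, hγ⟩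
    simp only [r, dif_pos h]
    exact h.choose_spec
  have hgn : ∀ n : ρ.ker, ρ (g * n) = t := fun n => by
    rw [map_mul, hg, MonoidHom.mem_ker.mp n.2, mul_one]
  obtain ⟨γ, hγ, hfin⟩ := Subgroup.exists_finiteIndex_of_leftCoset_cover (s := Γ) (H := K) (g := r)
    (by
      refine Set.eq_univ_of_forall fun n => ?_
      obtain ⟨w, hw, hwΓ⟩ := hcon (g * n) (hgn n)
      obtain ⟨w', hw', hγ'⟩ := hr _ n w hw rfl
      refine Set.mem_biUnion (x := ρ w) hwΓ ?_
      rw [Set.mem_smul_set_iff_inv_smul_mem, smul_eq_mul]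
      exact hKmem (ρ w) hwΓ (g * r (ρ w)) w' (g * n) w (hgn _) hγ' rfl hw' hw _ (by simp))
  exact hK γ hγ hfin

/-- The product of the images of the centralizers of suitable lifts of `t` avoids a given element
commuting with `t`. -/
theorem exists_lifts_forall_commute_ne_mul {L₁ L₂ P : Type} [Group L₁] [IsFreeGroup L₁] [Group L₂]
    [IsFreeGroup L₂] [Group P] (ρ₁ : L₁ →* P) (ρ₂ : L₂ →* P) (h₁ : Function.Surjective ρ₁)
    (h₂ : Function.Surjective ρ₂) (hN₁ : ∃ x ∈ ρ₁.ker, ∃ y ∈ ρ₁.ker, x * y ≠ y * x)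
    (hN₂ : ∃ x ∈ ρ₂.ker, ∃ y ∈ ρ₂.ker, x * y ≠ y * x) {f t : P} (hc : Commute t f)
    (hft : f ∉ Subgroup.zpowers t) :
    ∃ u v, ρ₁ u = t ∧ ρ₂ v = t ∧
      ∀ w₁ w₂, Commute w₁ u → Commute w₂ v → f ≠ ρ₁ w₁ * ρ₂ w₂ := by
  classical
  obtain ⟨u, hu, huf⟩ := exists_lift_forall_commute_notMem ρ₁ h₁ hN₁ t {f} (by simpa using ⟨hc, hft⟩)
  simp only [Finset.mem_singleton] at huf
  have hu1 : u ≠ 1 := by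
    rintro rfl
    obtain ⟨w, hw⟩ := h₁ f
    exact huf w (Commute.one_right w) hw
  obtain ⟨a, m, hm, rfl, ha⟩ := exists_root_of_ne_one hu1
  have hat : Commute (ρ₁ a) t := by
    rw [← hu]; exact ((Commute.refl a).pow_right m).map ρ₁
  have hpow : ∀ n : ℤ, ρ₁ a ^ n ≠ f := fun n hn =>
    huf (a ^ n) (((Commute.refl a).pow_right m).zpow_left n) (by rw [map_zpow, hn])
  obtain ⟨v, hv, hvΓ⟩ := exists_lift_forall_commute_notMem ρ₂ h₂ hN₂ t
    ((Finset.range m).image fun j => (ρ₁ a ^ j)⁻¹ * f) (by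
      intro γ hγ
      obtain ⟨j, -, rfl⟩ := Finset.mem_image.mp hγ
      refine ⟨((hat.pow_left j).inv_left.symm.mul_right hc).eq, ?_⟩
      rintro ⟨i, hi⟩
      refine hpow (j + m * i) ?_
      rw [zpow_add, zpow_mul, zpow_natCast, zpow_natCast, ← map_pow ρ₁ a m, hu]
      change t ^ i = _ at hi
      rw [hi, mul_inv_cancel_left])
  refine ⟨a ^ m, v, hu, hv, fun w₁ w₂ hw₁ hw₂ hf => ?_⟩
  obtain ⟨n, rfl⟩ := ha w₁ hw₁
  have hm' : (m : ℤ) ≠ 0 := by exact_mod_cast hm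
  obtain ⟨j, hj⟩ := Int.eq_ofNat_of_zero_le (Int.emod_nonneg n hm')
  have hjm : j < m := by
    have := Int.emod_lt_of_pos n (show (0 : ℤ) < m by omega)
    omega
  refine hvΓ (v ^ (n / m) * w₂) (((Commute.refl v).zpow_left _).mul_left hw₂)
    (Finset.mem_image.mpr ⟨j, Finset.mem_range.mpr hjm, ?_⟩)
  have hn : ρ₁ (a ^ n) = ρ₁ a ^ j * t ^ (n / m) := by
    rw [← hu, map_pow, ← zpow_natCast (ρ₁ a) m, ← zpow_mul, ← zpow_natCast (ρ₁ a) j, ← zpow_add,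
      map_zpow, ← hj, Int.emod_add_mul_ediv]
  rw [hf, hn, map_mul, map_zpow, hv]
  group

/-- In a `p`-conjugacy separable fiber product of free groups over `P` with noncommutative
kernels, every element of `P` is a power of its `k`-th power, for `k` prime to `p`. -/
theorem mem_zpowers_pow_of_conjSepC {p : ℕ} (hp : p.Prime) {G L₁ L₂ P : Type} [Group G] [Group L₁]
    [IsFreeGroup L₁] [Group L₂] [IsFreeGroup L₂] [Group P] (π₁ : G →* L₁) (π₂ : G →* L₂)
    (ρ₁ : L₁ →* P) (ρ₂ : L₂ →* P) (h₁ : Function.Surjective ρ₁) (h₂ : Function.Surjective ρ₂)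
    (hN₁ : ∃ x ∈ ρ₁.ker, ∃ y ∈ ρ₁.ker, x * y ≠ y * x)
    (hN₂ : ∃ x ∈ ρ₂.ker, ∃ y ∈ ρ₂.ker, x * y ≠ y * x)
    (hinj : ∀ x y, π₁ x = π₁ y → π₂ x = π₂ y → x = y) (hcomp : ∀ x, ρ₁ (π₁ x) = ρ₂ (π₂ x))
    (hfib : ∀ a b, ρ₁ a = ρ₂ b → ∃ x, π₁ x = a ∧ π₂ x = b) (hcs : ConjSepC (CP p) G)
    (f : P) (k : ℕ) (hk : k.Coprime p) : f ∈ Subgroup.zpowers (f ^ k) := by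
  by_contra hf
  obtain ⟨u, v, hu, hv, huv⟩ := exists_lifts_forall_commute_ne_mul ρ₁ ρ₂ h₁ h₂ hN₁ hN₂
    ((Commute.refl f).pow_left k) hf
  obtain ⟨z₁, hz₁⟩ := h₁ f
  obtain ⟨z₂, hz₂⟩ := h₂ f
  obtain ⟨Z, hZ₁, hZ₂⟩ := hfib z₁ z₂ (hz₁.trans hz₂.symm)
  obtain ⟨X, hX₁, hX₂⟩ := hfib u v (hu.trans hv.symm)
  obtain ⟨Y, hY₁, hY₂⟩ := hfib (z₁⁻¹ * u * z₁) v (by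
    rw [map_mul, map_mul, map_inv, hu, hv, hz₁, mul_assoc, ← pow_succ, pow_succ',
      inv_mul_cancel_left])
  obtain ⟨a, ha₁, ha₂⟩ := hfib ((z₁ ^ k)⁻¹ * u) 1 (by
    rw [map_mul, map_inv, map_pow, hz₁, hu, inv_mul_cancel, map_one])
  obtain ⟨b, hb₁, hb₂⟩ := hfib 1 ((z₂ ^ k)⁻¹ * v) (by
    rw [map_mul, map_inv, map_pow, hz₂, hv, inv_mul_cancel, map_one])
  have hXY : IsConj X Y := by
    by_contra hXY
    obtain ⟨M, ⟨_, hM⟩, φ, hφ⟩ := hcs X Y hXY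
    apply hφ
    have : Fact p.Prime := ⟨hp⟩
    obtain ⟨n, hn⟩ := (IsPGroup.iff_card (p := p)).mp hM
    obtain ⟨l, hl⟩ : ∃ l : ℕ, ∀ m : M.carrier, m ^ (k * l) = m := by
      have hcop : k.Coprime (Nat.card M.carrier) := by
        rw [hn]; exact hk.pow_right n
      obtain ⟨l, hl⟩ := Int.mod_coprime hcop
      have hpos : (0 : ℤ) < Nat.card M.carrier := by exact_mod_cast Nat.card_pos
      obtain ⟨l', hl'⟩ := Int.eq_ofNat_of_zero_le (Int.emod_nonneg l hpos.ne')
      refine ⟨l', fun m => ?_⟩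
      have h1 : k * l' ≡ 1 [MOD Nat.card M.carrier] := by
        rw [← Int.natCast_modEq_iff]
        push_cast
        change _ = (l' : ℤ) at hl'
        rw [← hl']
        exact ((Int.mod_modEq l _).mul_left _).trans hl
      have h2 := (pow_eq_pow_iff_modEq (x := m)).mpr (h1.of_dvd (orderOf_dvd_natCard m))
      rw [h2, pow_one]
    obtain ⟨z₀, hz₀₁, hz₀₂⟩ := hfib (z₁ ^ (k * l)) (v ^ l) (by
      rw [map_pow, map_pow, hz₁, hv, pow_mul])
    have e1 : z₀⁻¹ * X * z₀ = Z ^ k * ((Z ^ (k * l))⁻¹ * a * Z ^ (k * l)) * b := by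
      apply hinj
      · have hc : (z₁ ^ k) * (z₁ ^ (k * l))⁻¹ = (z₁ ^ (k * l))⁻¹ * z₁ ^ k :=
          (((Commute.refl z₁).pow_pow _ _).inv_right).eq
        simp only [map_mul, map_inv, map_pow, hz₀₁, hX₁, hZ₁, ha₁, hb₁, mul_one, ← mul_assoc]
        rw [hc, mul_inv_cancel_right]
      · simp only [map_mul, map_inv, map_pow, hz₀₂, hX₂, hZ₂, ha₂, hb₂]
        rw [mul_assoc, ← pow_succ', pow_succ]
        group
    have e2 : Y = Z ^ k * (Z⁻¹ * a * Z) * b := by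
      apply hinj
      · have hc : z₁ ^ k * z₁⁻¹ = z₁⁻¹ * z₁ ^ k := ((Commute.refl z₁).pow_left k).inv_right.eq
        simp only [map_mul, map_inv, map_pow, hY₁, hZ₁, ha₁, hb₁, mul_one, ← mul_assoc]
        rw [hc, mul_inv_cancel_right]
      · simp only [map_mul, map_inv, map_pow, hY₂, hZ₂, ha₂, hb₂]
        group
    refine isConj_iff.mpr ⟨φ z₀⁻¹, ?_⟩
    rw [← map_inv, inv_inv, ← map_mul, ← map_mul, e1, e2]
    simp only [map_mul, map_inv, map_pow, hl]
  obtain ⟨c, rfl⟩ := isConj_iff.mp hXY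
  refine huv (z₁ * π₁ c) (π₂ c)⁻¹ ?_ ?_ ?_
  · have h : π₁ c * u * (π₁ c)⁻¹ = z₁⁻¹ * u * z₁ := by
      rw [← hY₁, map_mul, map_mul, map_inv, hX₁]
    have h' : π₁ c * u = z₁⁻¹ * u * z₁ * π₁ c := by rw [← h]; group
    change z₁ * π₁ c * u = u * (z₁ * π₁ c)
    rw [mul_assoc, h']
    group
  · have h : π₂ c * v * (π₂ c)⁻¹ = v := by
      rw [← hX₂, ← map_mul, ← map_inv, ← map_mul, hY₂, hX₂]
    have h' : Commute (π₂ c) v := mul_inv_eq_iff_eq_mul.mp h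
    exact h'.inv_left
  · rw [map_mul, hcomp, map_inv, mul_inv_cancel_right, hz₁]

theorem eq_one_of_mem_zpowers_pow {P : Type} [Group P] {p q : ℕ} (hp : p.Prime) (hq : q.Prime)
    (hpq : p ≠ q) (h₁ : ∀ (f : P) (k : ℕ), k.Coprime p → f ∈ Subgroup.zpowers (f ^ k))
    (h₂ : ∀ (f : P) (k : ℕ), k.Coprime q → f ∈ Subgroup.zpowers (f ^ k)) (f : P) : f = 1 := by
  have hdvd : ∀ {r : ℕ}, f ∈ Subgroup.zpowers (f ^ r) →
      ∃ i : ℤ, (orderOf f : ℤ) ∣ r * i - 1 := fun {r} h => by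
    obtain ⟨i, hi⟩ := h
    refine ⟨i, orderOf_dvd_iff_zpow_eq_one.mpr ?_⟩
    change (f ^ r) ^ i = f at hi
    rw [zpow_sub, zpow_mul, zpow_natCast, hi, zpow_one, mul_inv_cancel]
  obtain ⟨j, hj⟩ := hdvd (h₂ f p ((Nat.coprime_primes hp hq).mpr hpq))
  have hcop : (orderOf f).Coprime p := by
    rw [Nat.coprime_comm, Nat.Prime.coprime_iff_not_dvd hp]
    intro hpd
    have h1 : (p : ℤ) ∣ p * j - 1 := (Int.natCast_dvd_natCast.mpr hpd).trans hj
    have h2 : (p : ℤ) ∣ 1 := (dvd_sub_right (dvd_mul_right _ _)).mp h1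
    exact hp.one_lt.ne' (Nat.dvd_one.mp (by exact_mod_cast h2))
  have h := h₁ f _ hcop
  rwa [pow_orderOf_eq_one, Subgroup.zpowers_one_eq_bot, Subgroup.mem_bot] at h

/-- A commutative normal subgroup of a free group is central. -/
theorem exists_not_commute_of_normal {F : Type} [Group F] [IsFreeGroup F] (N : Subgroup F)
    [N.Normal] {n x : F} (hn : n ∈ N) (hnx : n * x ≠ x * n) :
    ∃ a ∈ N, ∃ b ∈ N, a * b ≠ b * a := by
  by_contra! hcomm
  have hn1 : n ≠ 1 := by
    rintro rfl
    simp at hnx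
  obtain ⟨r, η, hη, hr⟩ := exists_zpow_of_commutative (F := N)
    (fun a b => Subtype.ext (hcomm a a.2 b b.2)) (x := ⟨n, hn⟩)
    (fun h => hn1 (congrArg Subtype.val h))
  obtain ⟨k, hk⟩ := hr ⟨n, hn⟩
  have hk' : n = (r : F) ^ k := congrArg Subtype.val hk
  have hconj : ∀ y : F, ∃ i : ℤ, y * r * y⁻¹ = (r : F) ^ i := fun y => by
    obtain ⟨i, hi⟩ := hr ⟨y * r * y⁻¹, ‹N.Normal›.conj_mem r r.2 y⟩
    exact ⟨i, congrArg Subtype.val hi⟩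
  obtain ⟨i, hi⟩ := hconj x
  obtain ⟨j, hj⟩ := hconj x⁻¹
  have hij : r = r ^ (i * j) := by
    refine Subtype.ext ?_
    have h : (x⁻¹ * r * x⁻¹⁻¹) ^ i = (r : F) := by
      rw [conj_zpow, ← hi]; group
    rw [hj, ← zpow_mul, mul_comm] at h
    simpa using h.symm
  have h1 : i * j = 1 := by
    have h := congrArg (fun y => (η y).toAdd) hij
    simp only [map_zpow, hη, toAdd_zpow, toAdd_ofAdd, smul_eq_mul, mul_one] at h
    exact h.symm
  have hrx2 : Commute (r : F) (x ^ 2) := by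
    have h2 : x * (x * r * x⁻¹) * x⁻¹ = r := by
      rw [hi, ← conj_zpow, hi, ← zpow_mul]
      rcases Int.isUnit_iff.mp (IsUnit.of_mul_eq_one _ h1) with rfl | rfl <;> simp
    change _ = _
    calc (r : F) * x ^ 2 = x * (x * r * x⁻¹) * x⁻¹ * x ^ 2 := by rw [h2]
      _ = x ^ 2 * r := by rw [pow_two]; group
  have hx2 : x ^ 2 ≠ 1 := fun h => by
    obtain ⟨S, ⟨e⟩⟩ := exists_freeGroup_mulEquiv F
    have h3 : (e x) ^ 2 = 1 ^ 2 := by rw [← map_pow, h, map_one, one_pow]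
    have hx1 : x = 1 := e.map_eq_one_iff.mp (pow_left_injective two_ne_zero h3)
    exact hnx (by simp [hx1])
  have hrx : Commute (r : F) x := commute_of_commute_ne_one hx2 hrx2 ((Commute.refl x).pow_right 2)
  exact hnx (by rw [hk']; exact (hrx.zpow_left k).eq)

/-- If the kernel of a map to a free group is central, then the group is the direct product of the
kernel and the image. -/
theorem nonempty_mulEquiv_ker_prod {G L : Type} [Group G] [Group L] [IsFreeGroup L] (π : G →* L)
    (hπ : Function.Surjective π) (hc : ∀ n ∈ π.ker, ∀ x, n * x = x * n) :
    Nonempty (G ≃* π.ker × L) := by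
  obtain ⟨S, ⟨e⟩⟩ := exists_freeGroup_mulEquiv L
  let σ : L →* G :=
    (FreeGroup.lift fun s => (hπ (e.symm (FreeGroup.of s))).choose).comp e.toMonoidHom
  have hσ : ∀ y, π (σ y) = y := by
    have h : π.comp (FreeGroup.lift fun s => (hπ (e.symm (FreeGroup.of s))).choose) =
        e.symm.toMonoidHom := by
      ext s
      simpa using (hπ (e.symm (FreeGroup.of s))).choose_spec
    intro y
    have h1 := DFunLike.congr_fun h (e y)
    simpa [σ] using h1
  refine ⟨(MulEquiv.ofBijective (MonoidHom.mk' (fun a : π.ker × L => (a.1 : G) * σ a.2)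
    fun a b => ?_) ⟨?_, fun x => ?_⟩).symm⟩
  · simp only [Prod.fst_mul, Prod.snd_mul, Subgroup.coe_mul, map_mul]
    rw [mul_assoc, mul_assoc, ← mul_assoc (b.1 : G), hc b.1 b.1.2 (σ a.2), mul_assoc]
  · rw [injective_iff_map_eq_one]
    rintro ⟨n, y⟩ h
    have h' : (n : G) * σ y = 1 := h
    have hy : y = 1 := by
      have h1 := congrArg π h'
      rwa [map_mul, MonoidHom.mem_ker.mp n.2, one_mul, hσ, map_one] at h1
    subst hy
    rw [map_one, mul_one] at h'
    exact Prod.ext (Subtype.ext h') rfl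
  · refine ⟨(⟨x * (σ (π x))⁻¹, ?_⟩, π x), ?_⟩
    · rw [MonoidHom.mem_ker, map_mul, map_inv, hσ, mul_inv_cancel]
    · exact inv_mul_cancel_right x (σ (π x))

theorem exists_freeGroup_prod_of_mulEquiv {G A B : Type} [Group G] [Group A] [Group B]
    [IsFreeGroup A] [IsFreeGroup B] (e : G ≃* A × B) :
    ∃ S T : Type, Nonempty (G ≃* FreeGroup S × FreeGroup T) := by
  obtain ⟨S, ⟨e₁⟩⟩ := exists_freeGroup_mulEquiv A
  obtain ⟨T, ⟨e₂⟩⟩ := exists_freeGroup_mulEquiv B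
  exact ⟨S, T, ⟨e.trans (e₁.prodCongr e₂)⟩⟩

/-- Subdirect products of two free groups with a central kernel are products of free groups. -/
theorem exists_freeGroup_prod_of_central {G L₁ L₂ : Type} [Group G] [Group L₁] [Group L₂]
    [IsFreeGroup L₁] [IsFreeGroup L₂] (π₁ : G →* L₁) (π₂ : G →* L₂)
    (h₂ : Function.Surjective π₂) (hinj : ∀ x y, π₁ x = π₁ y → π₂ x = π₂ y → x = y)
    (hc : ∀ n ∈ π₂.ker, ∀ x, n * x = x * n) :
    ∃ S T : Type, Nonempty (G ≃* FreeGroup S × FreeGroup T) := by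
  obtain ⟨e⟩ := nonempty_mulEquiv_ker_prod π₂ h₂ hc
  have hker : Function.Injective (π₁.comp π₂.ker.subtype) := fun a b h =>
    Subtype.ext (hinj _ _ h (a.2.trans b.2.symm))
  have : IsFreeGroup π₂.ker := IsFreeGroup.ofMulEquiv (MonoidHom.ofInjective hker).symm
  exact exists_freeGroup_prod_of_mulEquiv e

/-- A subdirect product of two free groups that is conjugacy separable for two primes is a direct
product of free groups. -/
theorem exists_freeGroup_prod_of_conjSepC {p q : ℕ} (hp : p.Prime) (hq : q.Prime) (hpq : p ≠ q)
    {G L₁ L₂ : Type} [Group G] [Group L₁] [Group L₂]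
    [IsFreeGroup L₁] [IsFreeGroup L₂] (π₁ : G →* L₁) (π₂ : G →* L₂)
    (h₁ : Function.Surjective π₁) (h₂ : Function.Surjective π₂)
    (hinj : ∀ x y, π₁ x = π₁ y → π₂ x = π₂ y → x = y)
    (hcp : ConjSepC (CP p) G) (hcq : ConjSepC (CP q) G) :
    ∃ S T : Type, Nonempty (G ≃* FreeGroup S × FreeGroup T) := by
  by_cases hc₂ : ∀ n ∈ π₂.ker, ∀ x, n * x = x * n
  · exact exists_freeGroup_prod_of_central π₁ π₂ h₂ hinj hc₂
  by_cases hc₁ : ∀ n ∈ π₁.ker, ∀ x, n * x = x * n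
  · exact exists_freeGroup_prod_of_central π₂ π₁ h₁ (fun x y h h' => hinj x y h' h) hc₁
  push Not at hc₁ hc₂
  let ρ₁ : L₁ →* G ⧸ (π₁.ker ⊔ π₂.ker) := π₁.liftOfSurjective h₁
    ⟨QuotientGroup.mk' (π₁.ker ⊔ π₂.ker), by rw [QuotientGroup.ker_mk']; exact le_sup_left⟩
  let ρ₂ : L₂ →* G ⧸ (π₁.ker ⊔ π₂.ker) := π₂.liftOfSurjective h₂
    ⟨QuotientGroup.mk' (π₁.ker ⊔ π₂.ker), by rw [QuotientGroup.ker_mk']; exact le_sup_right⟩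
  have hρ₁ : ∀ x, ρ₁ (π₁ x) = QuotientGroup.mk' (π₁.ker ⊔ π₂.ker) x := fun x =>
    MonoidHom.liftOfRightInverse_comp_apply π₁ _ (Function.rightInverse_surjInv h₁) _ x
  have hρ₂ : ∀ x, ρ₂ (π₂ x) = QuotientGroup.mk' (π₁.ker ⊔ π₂.ker) x := fun x =>
    MonoidHom.liftOfRightInverse_comp_apply π₂ _ (Function.rightInverse_surjInv h₂) _ x
  have hs₁ : Function.Surjective ρ₁ := fun f => by
    obtain ⟨x, rfl⟩ := QuotientGroup.mk'_surjective _ f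
    exact ⟨_, hρ₁ x⟩
  have hs₂ : Function.Surjective ρ₂ := fun f => by
    obtain ⟨x, rfl⟩ := QuotientGroup.mk'_surjective _ f
    exact ⟨_, hρ₂ x⟩
  have hcomp : ∀ x, ρ₁ (π₁ x) = ρ₂ (π₂ x) := fun x => (hρ₁ x).trans (hρ₂ x).symm
  have hfib : ∀ a b, ρ₁ a = ρ₂ b → ∃ x, π₁ x = a ∧ π₂ x = b := by
    intro a b h
    obtain ⟨x, rfl⟩ := h₁ a
    obtain ⟨y, rfl⟩ := h₂ b
    rw [hρ₁, hρ₂] at h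
    have h' : x⁻¹ * y ∈ π₁.ker ⊔ π₂.ker := QuotientGroup.eq.mp h
    obtain ⟨m, hm, n, hn, hmn⟩ := Subgroup.mem_sup_of_normal_left.mp h'
    refine ⟨x * m, by rw [map_mul, MonoidHom.mem_ker.mp hm, mul_one], ?_⟩
    have hy : y = x * m * n := by rw [mul_assoc, hmn, mul_inv_cancel_left]
    rw [hy, map_mul _ (x * m), MonoidHom.mem_ker.mp hn, mul_one]
  have hN₁ : ∃ x ∈ ρ₁.ker, ∃ y ∈ ρ₁.ker, x * y ≠ y * x := by
    obtain ⟨n, hn, x, hnx⟩ := hc₂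
    refine exists_not_commute_of_normal ρ₁.ker (n := π₁ n) (x := π₁ x) ?_ fun h => ?_
    · rw [MonoidHom.mem_ker, hcomp, MonoidHom.mem_ker.mp hn, map_one]
    · refine hnx (hinj _ _ (by rw [map_mul, map_mul, h]) ?_)
      rw [map_mul, map_mul, MonoidHom.mem_ker.mp hn, one_mul, mul_one]
  have hN₂ : ∃ x ∈ ρ₂.ker, ∃ y ∈ ρ₂.ker, x * y ≠ y * x := by
    obtain ⟨n, hn, x, hnx⟩ := hc₁
    refine exists_not_commute_of_normal ρ₂.ker (n := π₂ n) (x := π₂ x) ?_ fun h => ?_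
    · rw [MonoidHom.mem_ker, ← hcomp, MonoidHom.mem_ker.mp hn, map_one]
    · refine hnx (hinj _ _ ?_ (by rw [map_mul, map_mul, h]))
      rw [map_mul, map_mul, MonoidHom.mem_ker.mp hn, one_mul, mul_one]
  have htriv := eq_one_of_mem_zpowers_pow hp hq hpq
    (mem_zpowers_pow_of_conjSepC hp π₁ π₂ ρ₁ ρ₂ hs₁ hs₂ hN₁ hN₂ hinj hcomp hfib hcp)
    (mem_zpowers_pow_of_conjSepC hq π₁ π₂ ρ₁ ρ₂ hs₁ hs₂ hN₁ hN₂ hinj hcomp hfib hcq)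
  refine exists_freeGroup_prod_of_mulEquiv (A := L₁) (B := L₂)
    (MulEquiv.ofBijective (π₁.prod π₂) ⟨fun x y h => ?_, fun ⟨a, b⟩ => ?_⟩)
  · have h' := Prod.ext_iff.mp h
    exact hinj x y h'.1 h'.2
  · obtain ⟨x, hx₁, hx₂⟩ := hfib a b ((htriv _).trans (htriv _).symm)
    exact ⟨x, Prod.ext hx₁ hx₂⟩

theorem ConjSepC.of_mulEquiv {C : GrpB → Prop} {G H : Type} [Group G] [Group H] (e : G ≃* H)
    (h : ConjSepC C H) : ConjSepC C G := by
  intro x y hxy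
  obtain ⟨M, hM, φ, hφ⟩ := h (e x) (e y) fun hc => hxy (by
    simpa using e.symm.toMonoidHom.map_isConj hc)
  exact ⟨M, hM, φ.comp e.toMonoidHom, hφ⟩

theorem ConjSepC.prod {C : GrpB → Prop} {G H : Type} [Group G] [Group H] (hG : ConjSepC C G)
    (hH : ConjSepC C H) : ConjSepC C (G × H) := by
  intro x y hxy
  by_cases h₁ : IsConj x.1 y.1
  · obtain ⟨M, hM, φ, hφ⟩ := hH x.2 y.2 fun h₂ => hxy (by
      obtain ⟨c, hc⟩ := isConj_iff.mp h₁
      obtain ⟨d, hd⟩ := isConj_iff.mp h₂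
      exact isConj_iff.mpr ⟨(c, d), Prod.ext hc hd⟩)
    exact ⟨M, hM, φ.comp (MonoidHom.snd G H), hφ⟩
  · obtain ⟨M, hM, φ, hφ⟩ := hG x.1 y.1 h₁
    exact ⟨M, hM, φ.comp (MonoidHom.fst G H), hφ⟩

/-- Corollary 1.10: a subgroup of a direct product of two free
groups is `p`-conjugacy separable for at least two distinct primes `p` iff it is
itself isomorphic to a direct product of two free groups. -/
theorem stmt5 (F₁ F₂ : Type) [Group F₁] [Group F₂]
    (hF₁ : IsFreeGroupType F₁) (hF₂ : IsFreeGroupType F₂)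
    (G : Subgroup (F₁ × F₂)) :
    (∃ p q : ℕ, p.Prime ∧ q.Prime ∧ p ≠ q ∧ ConjSepC (CP p) ↥G ∧ ConjSepC (CP q) ↥G) ↔
    (∃ S T : Type, Nonempty (↥G ≃* FreeGroup S × FreeGroup T)) := by

  constructor
  · rintro ⟨p, q, hp, hq, hpq, hcp, hcq⟩
    obtain ⟨S₁, ⟨e₁⟩⟩ := hF₁
    obtain ⟨S₂, ⟨e₂⟩⟩ := hF₂
    have : IsFreeGroup F₁ := IsFreeGroup.ofMulEquiv e₁.symm
    have : IsFreeGroup F₂ := IsFreeGroup.ofMulEquiv e₂.symm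
    let π₁ : G →* F₁ := (MonoidHom.fst F₁ F₂).comp G.subtype
    let π₂ : G →* F₂ := (MonoidHom.snd F₁ F₂).comp G.subtype
    refine exists_freeGroup_prod_of_conjSepC hp hq hpq π₁.rangeRestrict π₂.rangeRestrict
      π₁.rangeRestrict_surjective π₂.rangeRestrict_surjective (fun x y h h' => ?_) hcp hcq
    exact Subtype.ext (Prod.ext (congrArg Subtype.val h) (congrArg Subtype.val h'))
  · rintro ⟨S, T, ⟨e⟩⟩
    exact ⟨2, 3, Nat.prime_two, Nat.prime_three, by decide,
      .of_mulEquiv e ((conjSepC_freeGroup Nat.prime_two).prod (conjSepC_freeGroup Nat.prime_two)),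
      .of_mulEquiv e
        ((conjSepC_freeGroup Nat.prime_three).prod (conjSepC_freeGroup Nat.prime_three))⟩
end

section
/- Let F₁ and F₂ be groups, let G ≤ F₁ × F₂ be a subdirect product, let 𝒞 be a pseudovariety of groups, and let X ⊆ F₁ be any subset. Then the product XG = {(x,1)·g : x ∈ X, g ∈ G} ⊆ F₁ × F₂ is closed in the pro-𝒞 topology on F₁ × F₂ if and only if XN₁ is closed in the pro-𝒞 topology on F₁, where N₁ := G ∩ F₁. -/
/-- `N` is the whole group or a co-`C` subgroup; these are the subgroups whose cosets form a
basis of the pro-`C` topology, including when `C` is empty. -/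
def IsTopOrCoC (C : GrpB → Prop) {F : Type} [Group F] (N : Subgroup F) : Prop :=
  N = ⊤ ∨ IsCoC C N

section

variable {C : GrpB → Prop} {F H : Type} [Group F] [Group H]

theorem isCoC_ker (hC : IsPseudovariety C) (f : H →* F) (hF : C (GrpB.of F)) :
    IsCoC C f.ker :=
  ⟨inferInstance, hC.1 _ _ (hC.2.1 (GrpB.of F) f.range hF)
    ⟨QuotientGroup.quotientKerEquivRange f⟩⟩

theorem IsTopOrCoC.ker (hC : IsPseudovariety C) {N : Subgroup F} [N.Normal]
    (hN : IsTopOrCoC C N) (f : H →* F ⧸ N) : IsTopOrCoC C f.ker := by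
  rcases hN with rfl | ⟨_, hN⟩
  · left
    have : Subsingleton (F ⧸ (⊤ : Subgroup F)) := QuotientGroup.subsingleton_quotient_top
    ext x
    simpa [MonoidHom.mem_ker] using Subsingleton.elim _ _
  · exact .inr (isCoC_ker hC f hN)

theorem IsTopOrCoC.normal {N : Subgroup F} (hN : IsTopOrCoC C N) : N.Normal := by
  rcases hN with rfl | ⟨h, _⟩
  · infer_instance
  · exact h

theorem IsTopOrCoC.comap (hC : IsPseudovariety C) {N : Subgroup F}
    (hN : IsTopOrCoC C N) (f : H →* F) : IsTopOrCoC C (N.comap f) := by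
  have := hN.normal
  have h := hN.ker hC ((QuotientGroup.mk' N).comp f)
  rwa [← MonoidHom.comap_ker, QuotientGroup.ker_mk'] at h

theorem IsTopOrCoC.inf (hC : IsPseudovariety C) {N M : Subgroup F}
    (hN : IsTopOrCoC C N) (hM : IsTopOrCoC C M) : IsTopOrCoC C (N ⊓ M) := by
  rcases hN with rfl | ⟨_, hN⟩
  · simpa using hM
  rcases hM with rfl | ⟨_, hM⟩
  · simpa [IsTopOrCoC] using Or.inr ⟨_, hN⟩
  right
  have h := isCoC_ker hC ((QuotientGroup.mk' N).prod (QuotientGroup.mk' M))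
    (hC.2.2.1 _ _ hN hM)
  rwa [MonoidHom.ker_prod, QuotientGroup.ker_mk', QuotientGroup.ker_mk'] at h

theorem IsTopOrCoC.mono (hC : IsPseudovariety C) {N M : Subgroup F} [M.Normal]
    (hN : IsTopOrCoC C N) (h : N ≤ M) : IsTopOrCoC C M := by
  rcases hN with rfl | ⟨_, hN⟩
  · exact .inl (top_le_iff.mp h)
  · obtain ⟨hiso, -, -, hquot⟩ := hC
    have : (M.map (QuotientGroup.mk' N)).Normal :=
      Subgroup.Normal.map ‹_› _ (QuotientGroup.mk'_surjective N)
    exact .inr ⟨inferInstance,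
      hiso _ _ (@hquot (GrpB.of (F ⧸ N)) (M.map (QuotientGroup.mk' N)) this hN)
        ⟨(QuotientGroup.quotientQuotientEquivQuotient N M h).symm⟩⟩

theorem cOpen_iff (hC : IsPseudovariety C) {U : Set F} :
    COpen C U ↔ ∀ x ∈ U, ∃ N : Subgroup F, IsTopOrCoC C N ∧ ∀ y, x⁻¹ * y ∈ N → y ∈ U := by
  constructor
  · intro hU
    change TopologicalSpace.GenerateOpen _ U at hU
    induction hU with
    | basic S hS =>
      obtain ⟨N, hN, g, rfl⟩ := hS
      intro x hx
      refine ⟨N, .inr hN, fun y hy => ?_⟩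
      simpa [mul_assoc] using N.mul_mem hx hy
    | univ => exact fun x _ => ⟨⊤, .inl rfl, fun _ _ => trivial⟩
    | inter S T _ _ hS hT =>
      intro x hx
      obtain ⟨N, hN, hNS⟩ := hS x hx.1
      obtain ⟨M, hM, hMT⟩ := hT x hx.2
      exact ⟨N ⊓ M, hN.inf hC hM, fun y hy => ⟨hNS y hy.1, hMT y hy.2⟩⟩
    | sUnion 𝒮 _ ih =>
      rintro x ⟨S, hS, hx⟩
      obtain ⟨N, hN, hNS⟩ := ih S hS x hx
      exact ⟨N, hN, fun y hy => ⟨S, hS, hNS y hy⟩⟩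
  · intro h
    let := ProCTop C F
    refine isOpen_iff_forall_mem_open.mpr fun x hx => ?_
    obtain ⟨N, hN | hN, hNU⟩ := h x hx
    · exact ⟨Set.univ, fun y _ => hNU y (by simp [hN]), isOpen_univ, trivial⟩
    · exact ⟨{y | x⁻¹ * y ∈ N}, hNU, .basic _ ⟨N, hN, x, rfl⟩, by simp⟩

theorem cClosed_iff (hC : IsPseudovariety C) {Y : Set F} :
    CClosed C Y ↔
      ∀ x ∉ Y, ∃ N : Subgroup F, IsTopOrCoC C N ∧ ∀ y, x⁻¹ * y ∈ N → y ∉ Y := by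
  rw [CClosed, ← @isOpen_compl_iff]
  exact cOpen_iff hC

theorem CClosed.preimage (hC : IsPseudovariety C) {Y : Set F} (hY : CClosed C Y)
    (f : H →* F) : CClosed C (f ⁻¹' Y) := by
  rw [cClosed_iff hC] at hY ⊢
  intro x hx
  obtain ⟨N, hN, hNY⟩ := hY (f x) hx
  exact ⟨N.comap f, hN.comap hC f, fun y hy => hNY (f y) (by simpa using hy)⟩

end

section

variable {F₁ F₂ : Type} [Group F₁] [Group F₂] {G : Subgroup (F₁ × F₂)}

theorem IsSubdirect.exists_left (hG : IsSubdirect G) (a : F₁) : ∃ b, (a, b) ∈ G := by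
  have h : a ∈ Subgroup.map (MonoidHom.fst F₁ F₂) G := by rw [hG.1]; trivial
  obtain ⟨⟨a, b⟩, h, rfl⟩ := h
  exact ⟨b, h⟩

theorem IsSubdirect.exists_right (hG : IsSubdirect G) (b : F₂) : ∃ a, (a, b) ∈ G := by
  have h : b ∈ Subgroup.map (MonoidHom.snd F₁ F₂) G := by rw [hG.2]; trivial
  obtain ⟨⟨a, b⟩, h, rfl⟩ := h
  exact ⟨a, h⟩

theorem IsSubdirect.normal_comap_inl (hG : IsSubdirect G) :
    (G.comap (MonoidHom.inl F₁ F₂)).Normal := by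
  refine ⟨fun n hn a => ?_⟩
  obtain ⟨b, hb⟩ := hG.exists_left a
  simpa using G.mul_mem (G.mul_mem hb hn) (G.inv_mem hb)

/-- Goursat's correspondence as a homomorphism: `G` is sent into the graph of a map
`F₂ →* F₁ ⧸ M`, for any normal `M` containing `G ∩ F₁`. -/
theorem IsSubdirect.exists_hom_quotient (hG : IsSubdirect G) (M : Subgroup F₁) [M.Normal]
    (hM : G.comap (MonoidHom.inl F₁ F₂) ≤ M) :
    ∃ ψ : F₂ →* F₁ ⧸ M, ∀ g ∈ G, ψ g.2 = (g.1 : F₁ ⧸ M) := by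
  let p : G →* F₂ := (MonoidHom.snd F₁ F₂).comp G.subtype
  let q : G →* F₁ ⧸ M := (QuotientGroup.mk' M).comp ((MonoidHom.fst F₁ F₂).comp G.subtype)
  have hp : Function.Surjective p := fun b =>
    let ⟨a, ha⟩ := hG.exists_right b
    ⟨⟨(a, b), ha⟩, rfl⟩
  have hpq : p.ker ≤ q.ker := by
    rintro ⟨⟨a, b⟩, h⟩ (rfl : b = 1)
    exact (QuotientGroup.eq_one_iff a).mpr (hM h)
  exact ⟨p.liftOfSurjective hp ⟨q, hpq⟩, fun g hg =>
    p.liftOfRightInverse_comp_apply _ (Function.rightInverse_surjInv hp) ⟨q, hpq⟩ ⟨g, hg⟩⟩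

/-- Membership in `XG` can be tested in the first factor, after translating by an element
of `G`. -/
theorem exists_eq_mk_mul_iff (X : Set F₁) {a c : F₁} {b : F₂} (hc : (c, b) ∈ G) :
    (∃ x ∈ X, ∃ g ∈ G, (a, b) = (x, (1 : F₂)) * g) ↔
      ∃ x ∈ X, ∃ n ∈ G.comap (MonoidHom.inl F₁ F₂), a * c⁻¹ = x * n := by
  refine exists_congr fun x => and_congr_right fun _ => ⟨?_, ?_⟩
  · rintro ⟨g, hg, h⟩
    refine ⟨x⁻¹ * (a * c⁻¹), ?_, by group⟩
    have hg' : g = (x⁻¹ * a, b) := by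
      rw [← inv_mul_eq_iff_eq_mul] at h
      simpa using h.symm
    subst hg'
    simpa [mul_assoc] using G.mul_mem hg (G.inv_mem hc)
  · rintro ⟨n, hn, h⟩
    refine ⟨_, G.mul_mem hn hc, ?_⟩
    simp [← mul_assoc, ← h]

end

/-- Lemma 3.7: for a subdirect product `G ≤ F₁ × F₂` and
`X ⊆ F₁`, the set `XG` is closed in the pro-`C` topology on `F₁ × F₂` iff `XN₁`
is closed in the pro-`C` topology on `F₁`. -/
theorem stmt6 (C : GrpB → Prop) (hC : IsPseudovariety C)
    (F₁ F₂ : Type) [Group F₁] [Group F₂]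
    (G : Subgroup (F₁ × F₂)) (hG : IsSubdirect G)
    (N₁ : Subgroup F₁) (hN₁ : N₁ = Subgroup.comap (MonoidHom.inl F₁ F₂) G)
    (X : Set F₁) :
    CClosed C {z : F₁ × F₂ | ∃ x ∈ X, ∃ g ∈ G, z = (x, (1 : F₂)) * g} ↔
    CClosed C {y : F₁ | ∃ x ∈ X, ∃ n ∈ N₁, y = x * n} := by
  subst hN₁
  have hnormal := hG.normal_comap_inl
  constructor
  · intro h
    convert h.preimage hC (MonoidHom.inl F₁ F₂) using 1
    ext y
    simp
  · intro h
    rw [cClosed_iff hC] at h ⊢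
    rintro ⟨a, b⟩ hab
    obtain ⟨c, hc⟩ := hG.exists_right b
    obtain ⟨N, hN, hNX⟩ := h (a * c⁻¹) (mt (exists_eq_mk_mul_iff X hc).mpr hab)
    have := hN.normal
    let M := N ⊔ G.comap (MonoidHom.inl F₁ F₂)
    have hM : IsTopOrCoC C M := hN.mono hC le_sup_left
    obtain ⟨ψ, hψ⟩ := hG.exists_hom_quotient M le_sup_right
    refine ⟨M.comap (MonoidHom.fst F₁ F₂) ⊓ (ψ.comp (MonoidHom.snd F₁ F₂)).ker,
      (hM.comap hC _).inf hC (hM.ker hC _), ?_⟩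
    rintro ⟨a', b'⟩ ⟨ha, hb⟩ hX
    obtain ⟨c', hc'⟩ := hG.exists_right b'
    obtain ⟨x, hx, n, hn, hxn⟩ := (exists_eq_mk_mul_iff X hc').mp hX
    have ha : (a : F₁ ⧸ M) = a' := QuotientGroup.eq.mpr ha
    have hb : (c : F₁ ⧸ M) = c' := by
      rw [← hψ _ hc, ← hψ _ hc']
      simpa [MonoidHom.mem_ker, inv_mul_eq_one] using hb
    have hM' : (a * c⁻¹)⁻¹ * (a' * c'⁻¹) ∈ M := by
      rw [← QuotientGroup.eq]
      simp only [QuotientGroup.mk_mul, QuotientGroup.mk_inv, ha, hb]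
    obtain ⟨m, hm, k, hk, hmk⟩ := Subgroup.mem_sup_of_normal_right.mp hM'
    refine hNX (a * c⁻¹ * m) (by simpa [mul_assoc] using hm) ⟨x, hx, n * k⁻¹,
      mul_mem hn (inv_mem hk), ?_⟩
    rw [← mul_assoc, ← hxn, eq_mul_inv_iff_mul_eq, mul_assoc, hmk]
    group
end

section
/- Let G ≤ F₁ × F₂ be a subdirect product of groups F₁ and F₂, and let 𝒞 be a pseudovariety of groups. Then the following are equivalent: (i) G is closed in the pro-𝒞 topology on F₁ × F₂; (ii) N₁ := G ∩ F₁ is closed in the pro-𝒞 topology on F₁; (iii) the quotient F₁/N₁ is residually-𝒞. -/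
/-- For nonempty `X`, being closed in the pro-`C` topology means that each point outside `X` is
separated from `X` by a homomorphism to a member of `C`. -/
theorem cClosed_iff_separated {C : GrpB → Prop} (hC : IsPseudovariety C) {F : Type} [Group F]
    {X : Set F} (hX : X.Nonempty) :
    CClosed C X ↔ ∀ x, x ∉ X → ∃ M : GrpB, C M ∧ ∃ φ : F →* M.carrier, ∀ y ∈ X, φ y ≠ φ x := by
  let : TopologicalSpace F := ProCTop C F
  constructor
  · intro h
    have hopen : TopologicalSpace.GenerateOpen
        {S : Set F | ∃ N : Subgroup F, IsCoC C N ∧ ∃ g : F, S = {x : F | g⁻¹ * x ∈ N}} Xᶜ :=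
      (isOpen_compl_iff (X := F)).2 h
    have key : Xᶜ = Set.univ ∨ ∀ x ∈ Xᶜ, ∃ M : GrpB, C M ∧ ∃ φ : F →* M.carrier,
        ∀ y, φ y = φ x → y ∈ Xᶜ := by
      generalize Xᶜ = U at hopen
      induction hopen with
      | basic s hs =>
        obtain ⟨N, ⟨hn, hN⟩, g, rfl⟩ := hs
        refine Or.inr fun x hx => ⟨_, hN, QuotientGroup.mk' N, fun y hy => ?_⟩
        have h1 : x⁻¹ * y ∈ N := QuotientGroup.eq.1 hy.symm
        have h2 := N.mul_mem hx h1
        simpa [mul_assoc] using h2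
      | univ => exact Or.inl rfl
      | inter s t _ _ hs ht =>
        rcases hs with rfl | hs
        · simpa using ht
        rcases ht with rfl | ht
        · simpa using Or.inr hs
        refine Or.inr fun x hx => ?_
        obtain ⟨M, hM, φ, hφ⟩ := hs x hx.1
        obtain ⟨M', hM', φ', hφ'⟩ := ht x hx.2
        refine ⟨_, hC.2.2.1 M M' hM hM', φ.prod φ', fun y hy => ?_⟩
        exact ⟨hφ y (congrArg Prod.fst hy), hφ' y (congrArg Prod.snd hy)⟩
      | sUnion S _ hS =>
        by_cases hu : Set.univ ∈ S
        · exact Or.inl (Set.eq_univ_of_univ_subset (Set.subset_sUnion_of_mem hu))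
        refine Or.inr ?_
        rintro x ⟨s, hs, hx⟩
        rcases hS s hs with rfl | h'
        · exact absurd hs hu
        obtain ⟨M, hM, φ, hφ⟩ := h' x hx
        exact ⟨M, hM, φ, fun y hy => ⟨s, hs, hφ y hy⟩⟩
    intro x hx
    rcases key with hu | key
    · obtain ⟨y, hy⟩ := hX
      exact absurd hy (hu ▸ Set.mem_univ y : y ∈ Xᶜ)
    · obtain ⟨M, hM, φ, hφ⟩ := key x hx
      exact ⟨M, hM, φ, fun y hy he => hφ y he hy⟩
  · intro h
    refine (isOpen_compl_iff (X := F)).1 (isOpen_iff_forall_mem_open.2 fun x hx => ?_)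
    obtain ⟨M, hM, φ, hφ⟩ := h x hx
    refine ⟨{y | x⁻¹ * y ∈ φ.ker}, fun y hy hyX => hφ y hyX ?_, ?_, by simp⟩
    · exact ((MonoidHom.eq_iff φ).2 hy)
    · refine TopologicalSpace.isOpen_generateFrom_of_mem
        ⟨φ.ker, ⟨inferInstance, ?_⟩, x, rfl⟩
      exact hC.1 _ _ (hC.2.1 M φ.range hM) ⟨QuotientGroup.quotientKerEquivRange φ⟩

/-- A normal subgroup is closed in the pro-`C` topology iff its quotient is residually-`C`. -/
theorem cClosed_normal_iff_residuallyC {C : GrpB → Prop} (hC : IsPseudovariety C) {F : Type}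
    [Group F] (N : Subgroup F) [N.Normal] :
    CClosed C (N : Set F) ↔ ResiduallyC C (F ⧸ N) := by
  rw [cClosed_iff_separated hC ⟨1, N.one_mem⟩]
  constructor
  · intro h p hp
    obtain ⟨x, rfl⟩ := QuotientGroup.mk_surjective p
    have hx : x ∉ N := fun hx => hp ((QuotientGroup.eq_one_iff x).2 hx)
    obtain ⟨M, hM, φ, hφ⟩ := h x hx
    have hnorm : (N.map φ.rangeRestrict).Normal :=
      Subgroup.Normal.map inferInstance _ φ.rangeRestrict_surjective
    have hquot := hC.2.2.2
    refine ⟨_, @hquot (GrpB.of φ.range) (N.map φ.rangeRestrict) hnorm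
      (hC.2.1 M φ.range hM),
      QuotientGroup.map N (N.map φ.rangeRestrict) φ.rangeRestrict (Subgroup.le_comap_map _ _), ?_⟩
    intro he
    have hm : φ.rangeRestrict x ∈ N.map φ.rangeRestrict := (QuotientGroup.eq_one_iff _).1 he
    obtain ⟨n, hn, hnx⟩ := hm
    exact hφ n hn (congrArg Subtype.val hnx)
  · intro h x hx
    obtain ⟨M, hM, φ, hφ⟩ := h (x : F ⧸ N) fun he => hx ((QuotientGroup.eq_one_iff x).1 he)
    refine ⟨M, hM, φ.comp (QuotientGroup.mk' N), fun y hy he => hφ ?_⟩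
    have hy1 : (y : F ⧸ N) = 1 := (QuotientGroup.eq_one_iff y).2 hy
    have he' : φ (y : F ⧸ N) = φ (x : F ⧸ N) := he
    rw [← he', hy1, map_one]

/-- A subdirect product `G ≤ F₁ × F₂` is the fibre product of the projection `F₁ → F₁ ⧸ N₁` with
a homomorphism `F₂ → F₁ ⧸ N₁`. -/
theorem IsSubdirect.exists_hom_mem_iff {F₁ F₂ : Type} [Group F₁] [Group F₂]
    {G : Subgroup (F₁ × F₂)} (hG : IsSubdirect G) (N₁ : Subgroup F₁)
    (hN₁ : N₁ = Subgroup.comap (MonoidHom.inl F₁ F₂) G) [N₁.Normal] :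
    ∃ ψ : F₂ →* F₁ ⧸ N₁, ∀ a b, (a, b) ∈ G ↔ (a : F₁ ⧸ N₁) = ψ b := by
  have hN : ∀ a, a ∈ N₁ ↔ (a, (1 : F₂)) ∈ G := fun a => by rw [hN₁]; rfl
  have hsurj : ∀ b : F₂, ∃ a, (a, b) ∈ G := fun b => by
    obtain ⟨⟨a, b'⟩, hab, rfl⟩ := hG.2.ge (Subgroup.mem_top b)
    exact ⟨a, hab⟩
  choose s hs using hsurj
  have key : ∀ a b, (a, b) ∈ G ↔ (a : F₁ ⧸ N₁) = (s b : F₁ ⧸ N₁) := fun a b => by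
    rw [eq_comm, QuotientGroup.eq, hN]
    have he : ((s b)⁻¹ * a, (1 : F₂)) = (s b, b)⁻¹ * (a, b) := by simp
    rw [he, Subgroup.mul_mem_cancel_left _ (G.inv_mem (hs b))]
  refine ⟨MonoidHom.mk' (fun b => (s b : F₁ ⧸ N₁)) fun b c => ?_, key⟩
  exact ((key _ _).1 (G.mul_mem (hs b) (hs c))).symm

/-- Corollary 3.8: for a subdirect product `G ≤ F₁ × F₂`:
`G` is `C`-closed in `F₁ × F₂` iff `N₁` is `C`-closed in `F₁` iff `F₁/N₁` is
residually-`C`. -/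
theorem stmt7 (C : GrpB → Prop) (hC : IsPseudovariety C)
    (F₁ F₂ : Type) [Group F₁] [Group F₂]
    (G : Subgroup (F₁ × F₂)) (hG : IsSubdirect G)
    (N₁ : Subgroup F₁) (hN₁ : N₁ = Subgroup.comap (MonoidHom.inl F₁ F₂) G) [N₁.Normal] :
    (CClosed C (G : Set (F₁ × F₂)) ↔ CClosed C (N₁ : Set F₁)) ∧
    (CClosed C (N₁ : Set F₁) ↔ ResiduallyC C (F₁ ⧸ N₁)) := by
  refine ⟨⟨fun h => ?_, fun h => ?_⟩, cClosed_normal_iff_residuallyC hC N₁⟩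
  · rw [cClosed_iff_separated hC ⟨1, G.one_mem⟩] at h
    rw [cClosed_iff_separated hC ⟨1, N₁.one_mem⟩]
    subst hN₁
    intro x hx
    obtain ⟨M, hM, φ, hφ⟩ := h (MonoidHom.inl F₁ F₂ x) hx
    exact ⟨M, hM, φ.comp (MonoidHom.inl F₁ F₂), fun y hy => hφ _ hy⟩
  · rw [cClosed_normal_iff_residuallyC hC] at h
    rw [cClosed_iff_separated hC ⟨1, G.one_mem⟩]
    obtain ⟨ψ, hψ⟩ := hG.exists_hom_mem_iff N₁ hN₁
    rintro ⟨x, y⟩ hxy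
    have hne : (x : F₁ ⧸ N₁) * (ψ y)⁻¹ ≠ 1 := fun he =>
      hxy ((hψ x y).2 (mul_inv_eq_one.1 he))
    obtain ⟨M, hM, φ, hφ⟩ := h _ hne
    refine ⟨_, hC.2.2.1 M M hM hM,
      (φ.comp (QuotientGroup.mk' N₁)).prodMap (φ.comp ψ), ?_⟩
    rintro ⟨a, b⟩ hab he
    have h1 : φ (a : F₁ ⧸ N₁) = φ (x : F₁ ⧸ N₁) := congrArg Prod.fst he
    have h2 : φ (ψ b) = φ (ψ y) := congrArg Prod.snd he
    rw [(hψ a b).1 hab] at h1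
    exact hφ (by rw [map_mul, map_inv, ← h1, ← h2, mul_inv_cancel])
end
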